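/- arXiv:2201.02157 — 2 statements merged into one kernel-verified Lean document; each statement's English description precedes it below -/
import Mathlib

section
/- Let Σ be a topologically transitive countable Markov shift and let φ : Σ → ℝ be a summable Markov potential with Var_1(φ) < ∞ and P_G(φ) < ∞, and for each t ≥ 1 let μ_t be a Gurevich–Markov measure for the potential tφ; assume ∫φ dμ_t > −∞ for every t ≥ 1. Then for all 1 ≤ t₁ < t₂: ∫φ dμ_{t₁} ≤ ∫φ dμ_{t₂}, and P_G(t₂φ) − t₂·∫φ dμ_{t₂} ≤ P_G(t₁φ) − t₁·∫φ dμ_{t₁} (i.e., the quantity P_G(tφ) − t∫φ dμ_t, which equals the metric entropy of the equilibrium state μ_t, is nonincreasing in t). -/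
open MeasureTheory Filter Topology BoundedContinuousFunction
open scoped ENNReal NNReal

noncomputable section

/-! ## Countable Markov shifts (one-sided) -/

/-- The one-sided countable Markov shift over the alphabet `ℕ` determined by the
transition matrix (relation) `A`. -/
structure MShift (A : ℕ → ℕ → Prop) : Type where
  seq : ℕ → ℕ
  adm : ∀ i : ℕ, A (seq i) (seq (i + 1))

/-- The topology generated by the cylinders: the topology induced from the product
topology on `ℕ → ℕ` (with `ℕ` discrete). -/
instance (A : ℕ → ℕ → Prop) : TopologicalSpace (MShift A) :=
  TopologicalSpace.induced MShift.seq inferInstance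

/-- The Borel σ-algebra on the shift space. -/
instance (A : ℕ → ℕ → Prop) : MeasurableSpace (MShift A) := borel (MShift A)

instance (A : ℕ → ℕ → Prop) : BorelSpace (MShift A) := ⟨rfl⟩

/-- The shift map `σ`. -/
def shiftMap (A : ℕ → ℕ → Prop) (x : MShift A) : MShift A :=
  ⟨fun i => x.seq (i + 1), fun i => x.adm (i + 1)⟩

/-- No row and no column of the transition matrix is identically zero. -/
def NoZeroRC (A : ℕ → ℕ → Prop) : Prop :=
  ∀ i : ℕ, (∃ j, A i j) ∧ (∃ j, A j i)

/-- The cylinder `[x₀ … x_{n-1}]` determined by a finite word `w`. -/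
def cylSet (A : ℕ → ℕ → Prop) (w : List ℕ) : Set (MShift A) :=
  {x | ∀ i < w.length, x.seq i = w.getD i 0}

/-- A path: an admissible word `x₀ … xₙ` with `n ≥ 1` and nonempty cylinder. -/
def IsPath (A : ℕ → ℕ → Prop) (w : List ℕ) : Prop :=
  2 ≤ w.length ∧ w.Chain' A ∧ (cylSet A w).Nonempty

/-- The length `l(γ) = n` of a path `γ = x₀ … xₙ` (represented as a list of `n+1` symbols). -/
def pathLen (w : List ℕ) : ℕ := w.length - 1

/-- The weight `φ(γ) = Σ_{k=0}^{n-1} ψ(x_k x_{k+1})` of a word under a Markov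
potential determined by `ψ : ℕ → ℕ → ℝ`. -/
def pathWt (ψ : ℕ → ℕ → ℝ) : List ℕ → ℝ
  | [] => 0
  | [_] => 0
  | a :: b :: l => ψ a b + pathWt ψ (b :: l)

/-- Topological transitivity: any two symbols are connected by a path. -/
def TopTrans (A : ℕ → ℕ → Prop) : Prop :=
  ∀ a b : ℕ, ∃ w : List ℕ, IsPath A w ∧ w.headI = a ∧ w.getLastD 0 = b

/-- The Birkhoff sum `Sₙφ`. -/
def birkhoff (A : ℕ → ℕ → Prop) (φ : MShift A → ℝ) (n : ℕ) (x : MShift A) : ℝ :=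
  ∑ i ∈ Finset.range n, φ ((shiftMap A)^[i] x)

/-- The Gurevich partition function `Zₙ(φ, a)`. -/
def Zpart (A : ℕ → ℕ → Prop) (φ : MShift A → ℝ) (n : ℕ) (a : ℕ) : ℝ≥0∞ :=
  ∑' x : {x : MShift A // (shiftMap A)^[n] x = x ∧ x.seq 0 = a},
    ENNReal.ofReal (Real.exp (birkhoff A φ n x.1))

/-- `Zₙ*(φ, a)`: the partition function restricted to first returns to `a`. -/
def ZpartStar (A : ℕ → ℕ → Prop) (φ : MShift A → ℝ) (n : ℕ) (a : ℕ) : ℝ≥0∞ :=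
  ∑' x : {x : MShift A // (shiftMap A)^[n] x = x ∧ x.seq 0 = a ∧
      ∀ k, 0 < k → k < n → x.seq k ≠ a},
    ENNReal.ofReal (Real.exp (birkhoff A φ n x.1))

/-- The Gurevich pressure `P_G(φ) = limsup (1/n) log Zₙ(φ, a)` (at the symbol `a`),
as an extended real number. -/
def PGur (A : ℕ → ℕ → Prop) (φ : MShift A → ℝ) (a : ℕ) : EReal :=
  Filter.atTop.limsup fun n : ℕ => (((n : ℝ)⁻¹ : ℝ) : EReal) * ENNReal.log (Zpart A φ n a)

/-- `p` is the (common, symbol-independent) value of the Gurevich pressure of `φ`. -/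
def IsPG (A : ℕ → ℕ → Prop) (φ : MShift A → ℝ) (p : EReal) : Prop :=
  ∀ a : ℕ, (∃ x : MShift A, x.seq 0 = a) → PGur A φ a = p

/-- `φ` is a summable potential: `Σᵢ exp (sup φ|_[i]) < ∞`. -/
def SummablePot (A : ℕ → ℕ → Prop) (φ : MShift A → ℝ) : Prop :=
  ∃ s : ℕ → ℝ, Summable (fun i => Real.exp (s i)) ∧
    ∀ (i : ℕ) (x : MShift A), x.seq 0 = i → φ x ≤ s i

/-- `V` is a bound for the `n`-th variation `Varₙ(φ)`. -/
def VarBdd (A : ℕ → ℕ → Prop) (φ : MShift A → ℝ) (n : ℕ) (V : ℝ) : Prop :=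
  ∀ x y : MShift A, (∀ i < n, x.seq i = y.seq i) → |φ x - φ y| ≤ V

/-- σ-invariance of a Borel measure on the shift space. -/
def ShiftInv (A : ℕ → ℕ → Prop) (μ : Measure (MShift A)) : Prop :=
  ∀ s : Set (MShift A), MeasurableSet s → μ (shiftMap A ⁻¹' s) = μ s

/-- The maximal ergodic average `α(φ)`. -/
def alphaSup (A : ℕ → ℕ → Prop) (φ : MShift A → ℝ) : ℝ :=
  sSup {r : ℝ | ∃ μ : Measure (MShift A), IsProbabilityMeasure μ ∧ ShiftInv A μ ∧
    Integrable φ μ ∧ r = ∫ x, φ x ∂μ}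

/-- `μ` is the Gurevich–Markov (stationary Markov equilibrium) measure associated to the
Markov potential `ψ` with pressure `p`. -/
structure IsGM (A : ℕ → ℕ → Prop) (ψ : ℕ → ℕ → ℝ) (p : ℝ) (μ : Measure (MShift A)) : Prop where
  prob : IsProbabilityMeasure μ
  inv : ShiftInv A μ
  eigen : ∃ h hT : ℕ → ℝ, (∀ a, 0 < h a) ∧ (∀ a, 0 < hT a) ∧
    (∀ j : ℕ, (∑' a : {a : ℕ // A a j}, ENNReal.ofReal (Real.exp (ψ a.1 j) * h a.1))
        = ENNReal.ofReal (Real.exp p * h j)) ∧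
    (∀ j : ℕ, (∑' b : {b : ℕ // A j b}, ENNReal.ofReal (Real.exp (ψ j b.1) * hT b.1))
        = ENNReal.ofReal (Real.exp p * hT j)) ∧
    (∑' a : ℕ, ENNReal.ofReal (h a * hT a)) = 1 ∧
    (∀ w : List ℕ, w ≠ [] → w.Chain' A → (cylSet A w).Nonempty →
      μ (cylSet A w) = ENNReal.ofReal
        (h w.headI * hT (w.getLastD 0) * Real.exp (pathWt ψ w - (pathLen w : ℝ) * p)))

/-! ## Loops and main paths (one-sided) -/

/-- A loop at `a`. -/
def IsLoopAt (A : ℕ → ℕ → Prop) (a : ℕ) (w : List ℕ) : Prop :=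
  IsPath A w ∧ w.headI = a ∧ w.getLastD 0 = a

/-- The word `w` passes through `b`, i.e. some intermediate symbol of `w` equals `b`. -/
def PassesThrough (w : List ℕ) (b : ℕ) : Prop :=
  ∃ m, 0 < m ∧ m < w.length - 1 ∧ w.getD m 0 = b

/-- No intermediate symbol of `w` lies in `J`. -/
def AvoidsIn (w : List ℕ) (J : Finset ℕ) : Prop :=
  ∀ m, 0 < m → m < w.length - 1 → w.getD m 0 ∉ J

/-- A first-return loop at `c`: a loop at `c` with no intermediate occurrence of `c`. -/
def FirstRetLoop (A : ℕ → ℕ → Prop) (c : ℕ) (w : List ℕ) : Prop :=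
  IsPath A w ∧ w.headI = c ∧ w.getLastD 0 = c ∧
    ∀ m, 0 < m → m < w.length - 1 → w.getD m 0 ≠ c

/-- A main path from `i` to `j` (relative to the pair of symbols `{a, b}`): a path from
`i` to `j` with no intermediate occurrence of `a` nor of `b`. -/
def MainPath (A : ℕ → ℕ → Prop) (a b i j : ℕ) (w : List ℕ) : Prop :=
  IsPath A w ∧ w.headI = i ∧ w.getLastD 0 = j ∧
    ∀ m, 0 < m → m < w.length - 1 → w.getD m 0 ≠ a ∧ w.getD m 0 ≠ b

/-- `p_{ij}^t`: the sum of `exp(ψ(γ) − l(γ)·p)` over all main paths from `i` to `j`. -/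
def pSum (A : ℕ → ℕ → Prop) (ψ : ℕ → ℕ → ℝ) (p : ℝ) (a b i j : ℕ) : ℝ≥0∞ :=
  ∑' w : {w : List ℕ // MainPath A a b i j w},
    ENNReal.ofReal (Real.exp (pathWt ψ w.1 - (pathLen w.1 : ℝ) * p))

/-- `r_{ij}^t`: as `pSum`, restricted to main paths all of whose symbols lie in `S'`. -/
def rSum (A : ℕ → ℕ → Prop) (ψ : ℕ → ℕ → ℝ) (p : ℝ) (a b i j : ℕ) (S' : Finset ℕ) : ℝ≥0∞ :=
  ∑' w : {w : List ℕ // MainPath A a b i j w ∧ ∀ m < w.length, w.getD m 0 ∈ S'},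
    ENNReal.ofReal (Real.exp (pathWt ψ w.1 - (pathLen w.1 : ℝ) * p))

/-- Number of intermediate occurrences of symbols of `I` in the word `w`. -/
def interCount (I : Finset ℕ) (w : List ℕ) : ℕ :=
  ((w.drop 1).take (w.length - 2)).countP (fun s => decide (s ∈ I))

/-- `p_{ij}^t(n)`: as `pSum`, restricted to main paths with exactly `n` intermediate
occurrences of symbols of `I`. -/
def pSumN (A : ℕ → ℕ → Prop) (ψ : ℕ → ℕ → ℝ) (p : ℝ) (a b i j : ℕ)
    (I : Finset ℕ) (n : ℕ) : ℝ≥0∞ :=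
  ∑' w : {w : List ℕ // MainPath A a b i j w ∧ interCount I w = n},
    ENNReal.ofReal (Real.exp (pathWt ψ w.1 - (pathLen w.1 : ℝ) * p))

/-- An `I`-free path from `i` to `j`: a path from `i` to `j` with no intermediate
symbol in `I`. -/
def IFree (A : ℕ → ℕ → Prop) (I : Finset ℕ) (i j : ℕ) (w : List ℕ) : Prop :=
  IsPath A w ∧ w.headI = i ∧ w.getLastD 0 = j ∧
    ∀ m, 0 < m → m < w.length - 1 → w.getD m 0 ∉ I

/-! ## Two-sided countable Markov shifts -/

/-- The two-sided countable Markov shift determined by `A`. -/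
structure MShift2 (A : ℕ → ℕ → Prop) : Type where
  seq : ℤ → ℕ
  adm : ∀ i : ℤ, A (seq i) (seq (i + 1))

instance (A : ℕ → ℕ → Prop) : TopologicalSpace (MShift2 A) :=
  TopologicalSpace.induced MShift2.seq inferInstance

instance (A : ℕ → ℕ → Prop) : MeasurableSpace (MShift2 A) := borel (MShift2 A)

instance (A : ℕ → ℕ → Prop) : BorelSpace (MShift2 A) := ⟨rfl⟩

/-- The (invertible) shift map on the two-sided shift. -/
def shiftMap2 (A : ℕ → ℕ → Prop) (x : MShift2 A) : MShift2 A :=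
  ⟨fun i => x.seq (i + 1), fun i => x.adm (i + 1)⟩

/-- Cylinder based at coordinate 0 in the two-sided shift. -/
def cylSet2 (A : ℕ → ℕ → Prop) (w : List ℕ) : Set (MShift2 A) :=
  {x | ∀ i < w.length, x.seq (i : ℤ) = w.getD i 0}

/-- A path in the two-sided shift: an admissible word `x₀ … xₙ`, `n ≥ 1`. -/
def IsPath2 (A : ℕ → ℕ → Prop) (w : List ℕ) : Prop :=
  2 ≤ w.length ∧ w.Chain' A

/-- σ-invariance of a Borel measure on the two-sided shift. -/
def ShiftInv2 (A : ℕ → ℕ → Prop) (μ : Measure (MShift2 A)) : Prop :=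
  ∀ s : Set (MShift2 A), MeasurableSet s → μ (shiftMap2 A ⁻¹' s) = μ s

/-- Main path from `i` to `j` relative to `{a, b}` in the two-sided shift. -/
def MainPath2 (A : ℕ → ℕ → Prop) (a b i j : ℕ) (w : List ℕ) : Prop :=
  IsPath2 A w ∧ w.headI = i ∧ w.getLastD 0 = j ∧
    ∀ m, 0 < m → m < w.length - 1 → w.getD m 0 ≠ a ∧ w.getD m 0 ≠ b

/-- `p_{ij}`: the sum of `exp(ψ(γ) − l(γ)·P)` over all main paths from `i` to `j`
in the two-sided shift. -/
def pSum2 (A : ℕ → ℕ → Prop) (ψ : ℕ → ℕ → ℝ) (P : ℝ) (a b i j : ℕ) : ℝ≥0∞ :=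
  ∑' w : {w : List ℕ // MainPath2 A a b i j w},
    ENNReal.ofReal (Real.exp (pathWt ψ w.1 - (pathLen w.1 : ℝ) * P))

/-! ## The Ruelle operator and the renewal shift -/

/-- The Ruelle (transfer) operator acting on nonnegative measurable functions. -/
def ruelleOp (A : ℕ → ℕ → Prop) (ψ : MShift A → ℝ) (f : MShift A → ℝ≥0∞)
    (x : MShift A) : ℝ≥0∞ :=
  ∑' y : {y : MShift A // shiftMap A y = x}, ENNReal.ofReal (Real.exp (ψ y.1)) * f y.1

/-- The transition matrix of the renewal shift: `A(1,1) = A(1,i) = A(i, i-1) = 1` for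
every `i > 1`, all other entries `0` (alphabet `{1, 2, …}`). -/
def renewalA : ℕ → ℕ → Prop := fun i j => (i = 1 ∧ 1 ≤ j) ∨ (2 ≤ i ∧ j = i - 1)

/-- The potential `φ(x) = -x₀` on the renewal shift. -/
def phiRen : MShift renewalA → ℝ := fun x => -(x.seq 0 : ℝ)

/-- The potential `φ(x) = x₀ - x₁` on the renewal shift. -/
def phiRen2 : MShift renewalA → ℝ := fun x => (x.seq 0 : ℝ) - (x.seq 1 : ℝ)

/-- The fixed point `1̄ = (1,1,1,…)` of the renewal shift. -/
def onebar : MShift renewalA := ⟨fun _ => 1, fun _ => Or.inl ⟨rfl, le_refl 1⟩⟩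

end

/-- If a coboundary `f ∘ T - f` is bounded above by an integrable function, then it is
integrable with zero integral. -/
theorem integrable_coboundary {X : Type*} [MeasurableSpace X] {μ : Measure X}
    [IsProbabilityMeasure μ] {T : X → X} (hT : MeasurePreserving T μ μ) {f : X → ℝ}
    (hf : Measurable f) {k : X → ℝ} (hk : Integrable k μ) (hle : ∀ x, f (T x) - f x ≤ k x) :
    Integrable (fun x => f (T x) - f x) μ ∧ ∫ x, (f (T x) - f x) ∂μ = 0 := by
  let c : ℕ → ℝ → ℝ := fun n r => max (-(n : ℝ)) (min r n)
  have hc_abs : ∀ n r, |c n r| ≤ n := fun n r => abs_le.2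
    ⟨le_max_left _ _, max_le (by linarith [n.cast_nonneg (α := ℝ)]) (min_le_right _ _)⟩
  have hc_mono : ∀ n, Monotone (c n) := fun n a b hab =>
    max_le_max le_rfl (min_le_min hab le_rfl)
  have hc_lip : ∀ n a b, |c n a - c n b| ≤ |a - b| := fun n a b =>
    (abs_max_sub_max_le_max _ _ _ _).trans <| max_le (by simp) <|
      (abs_min_sub_min_le_max a n b n).trans (by simp)
  have hc_meas : ∀ n, Measurable (c n) := fun n => by fun_prop
  have hc_lim : ∀ r, Tendsto (fun n => c n r) atTop (𝓝 r) := fun r => by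
    obtain ⟨N, hN⟩ := exists_nat_ge |r|
    refine tendsto_const_nhds.congr' ?_
    filter_upwards [eventually_ge_atTop N] with n hn
    have hn' : (N : ℝ) ≤ n := by exact_mod_cast hn
    have := abs_le.1 (hN.trans hn')
    simp only [c]
    rw [min_eq_left this.2, max_eq_right this.1]
  have hci : ∀ n, Integrable (fun x => c n (f x)) μ := fun n =>
    Integrable.of_bound ((hc_meas n).comp hf).aestronglyMeasurable n
      (ae_of_all _ fun x => hc_abs n (f x))
  have hciT : ∀ n, Integrable (fun x => c n (f (T x))) μ := fun n =>
    hT.integrable_comp_of_integrable (hci n)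
  have hzero : ∀ n, ∫ x, (c n (f (T x)) - c n (f x)) ∂μ = 0 := fun n => by
    rw [integral_sub (hciT n) (hci n), sub_eq_zero]
    conv_rhs => rw [← hT.map_eq]
    exact (integral_map hT.aemeasurable
      ((hc_meas n).comp hf).aestronglyMeasurable).symm
  have hGle : ∀ n x, c n (f (T x)) - c n (f x) ≤ |k x| := fun n x => by
    rcases le_total (f (T x)) (f x) with h | h
    · linarith [hc_mono n h, abs_nonneg (k x)]
    · have h₁ := (le_abs_self _).trans (hc_lip n (f (T x)) (f x))
      rw [abs_of_nonneg (sub_nonneg.2 h)] at h₁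
      exact h₁.trans ((hle x).trans (le_abs_self _))
  have hlim : ∀ x, Tendsto (fun n => c n (f (T x)) - c n (f x)) atTop (𝓝 (f (T x) - f x)) :=
    fun x => (hc_lim _).sub (hc_lim _)
  have hfT : Measurable fun x => f (T x) := hf.comp hT.measurable
  have hint : Integrable (fun x => |k x| - (f (T x) - f x)) μ := by
    have : ∀ n, ∫⁻ x, ‖|k x| - (c n (f (T x)) - c n (f x))‖ₑ ∂μ
        = ENNReal.ofReal (∫ x, |k x| ∂μ) := fun n => by
      refine (ofReal_integral_norm_eq_lintegral_enorm
        (hk.abs.sub ((hciT n).sub (hci n)))).symm.trans ?_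
      congr 1
      calc ∫ x, ‖|k x| - (c n (f (T x)) - c n (f x))‖ ∂μ
          = ∫ x, (|k x| - (c n (f (T x)) - c n (f x))) ∂μ :=
            integral_congr_ae (ae_of_all _ fun x =>
              Real.norm_of_nonneg (sub_nonneg.2 (hGle n x)))
        _ = ∫ x, |k x| ∂μ := by
            refine (integral_sub hk.abs ((hciT n).sub (hci n))).trans ?_
            simp only [Pi.sub_apply, hzero n, sub_zero]
    refine ⟨hk.abs.aestronglyMeasurable.sub (hfT.sub hf).aestronglyMeasurable, ?_⟩
    calc ∫⁻ x, ‖|k x| - (f (T x) - f x)‖ₑ ∂μ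
        = ∫⁻ x, liminf (fun n => ‖|k x| - (c n (f (T x)) - c n (f x))‖ₑ) atTop ∂μ :=
          lintegral_congr fun x => (((hlim x).const_sub _).enorm.liminf_eq).symm
      _ ≤ liminf (fun n => ∫⁻ x, ‖|k x| - (c n (f (T x)) - c n (f x))‖ₑ ∂μ) atTop :=
          lintegral_liminf_le' fun n =>
            (hk.abs.sub ((hciT n).sub (hci n))).aestronglyMeasurable.enorm
      _ < ∞ := by simp [this]
  have hg : Integrable (fun x => f (T x) - f x) μ :=
    (hk.abs.sub hint).congr (ae_of_all _ fun x => by simp)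
  refine ⟨hg, tendsto_nhds_unique ?_ (tendsto_const_nhds (x := (0 : ℝ)) (f := atTop (α := ℕ)))⟩
  have := tendsto_integral_of_dominated_convergence (fun x => |f (T x) - f x|)
    (fun n => ((hciT n).sub (hci n)).aestronglyMeasurable) hg.abs
    (fun n => ae_of_all _ fun x => hc_lip n (f (T x)) (f x)) (ae_of_all _ hlim)
  simpa only [Pi.sub_apply, hzero] using this

/-- Gibbs inequality for an integrable function modified by a coboundary. -/
theorem integral_nonpos_of_lintegral_exp_add_coboundary_le_one {X : Type*} [MeasurableSpace X]
    {μ : Measure X} [IsProbabilityMeasure μ] {T : X → X} (hT : MeasurePreserving T μ μ)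
    {u f : X → ℝ} (hu : Integrable u μ) (hum : Measurable u) (hf : Measurable f)
    (hexp : ∫⁻ x, ENNReal.ofReal (Real.exp (u x + (f (T x) - f x))) ∂μ ≤ 1) :
    ∫ x, u x ∂μ ≤ 0 := by
  have hfT : Measurable fun x => f (T x) := hf.comp hT.measurable
  have hEm : Measurable fun x => Real.exp (u x + (f (T x) - f x)) :=
    (hum.add (hfT.sub hf)).exp
  have hE : Integrable (fun x => Real.exp (u x + (f (T x) - f x))) μ :=
    ⟨hEm.aestronglyMeasurable, by
      rw [hasFiniteIntegral_iff_ofReal (ae_of_all _ fun x => (Real.exp_pos _).le)]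
      exact hexp.trans_lt ENNReal.one_lt_top⟩
  have hE1 : ∫ x, Real.exp (u x + (f (T x) - f x)) ∂μ ≤ 1 := by
    rw [integral_eq_lintegral_of_nonneg_ae (ae_of_all _ fun x => (Real.exp_pos _).le)
      hEm.aestronglyMeasurable]
    exact ENNReal.toReal_le_of_le_ofReal zero_le_one (by simpa using hexp)
  have hle : ∀ x, f (T x) - f x ≤ Real.exp (u x + (f (T x) - f x)) - 1 - u x := fun x => by
    linarith [Real.add_one_le_exp (u x + (f (T x) - f x))]
  have hE_sub : Integrable (fun x => Real.exp (u x + (f (T x) - f x)) - 1) μ :=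
    hE.sub (integrable_const _)
  have hk : Integrable (fun x => Real.exp (u x + (f (T x) - f x)) - 1 - u x) μ :=
    hE_sub.sub hu
  obtain ⟨hg, hg0⟩ := integrable_coboundary hT hf hk hle
  have h := integral_mono hg hk hle
  have h₂ : ∫ x, (Real.exp (u x + (f (T x) - f x)) - 1 - u x) ∂μ
      = ∫ x, Real.exp (u x + (f (T x) - f x)) ∂μ - 1 - ∫ x, u x ∂μ := by
    rw [integral_sub hE_sub hu, integral_sub hE (integrable_const (1 : ℝ))]
    simp
  rw [hg0] at h
  linarith

theorem MShift.measurable_seq {A : ℕ → ℕ → Prop} (i : ℕ) :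
    Measurable fun x : MShift A => x.seq i :=
  ((continuous_apply i).comp
    (continuous_induced_dom : Continuous (MShift.seq : MShift A → ℕ → ℕ))).measurable

theorem measurable_shiftMap (A : ℕ → ℕ → Prop) : Measurable (shiftMap A) :=
  (continuous_induced_rng.2 <| continuous_pi fun i =>
    (continuous_apply (i + 1)).comp continuous_induced_dom).measurable

theorem ShiftInv.measurePreserving {A : ℕ → ℕ → Prop} {μ : Measure (MShift A)}
    (h : ShiftInv A μ) : MeasurePreserving (shiftMap A) μ μ :=
  ⟨measurable_shiftMap A, Measure.ext fun s hs => by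
    rw [Measure.map_apply (measurable_shiftMap A) hs, h s hs]⟩

/-- The integral of a function of the first two symbols as a sum over two-letter words. -/
theorem lintegral_eq_tsum_cylSet {A : ℕ → ℕ → Prop} (μ : Measure (MShift A))
    (F : ℕ → ℕ → ℝ≥0∞) :
    ∫⁻ x, F (x.seq 0) (x.seq 1) ∂μ = ∑' i, ∑' j, F i j * μ (cylSet A [i, j]) := by
  have hm : Measurable fun x : MShift A => (x.seq 0, x.seq 1) :=
    (MShift.measurable_seq 0).prodMk (MShift.measurable_seq 1)
  have h := lintegral_map (μ := μ) (f := fun p : ℕ × ℕ => F p.1 p.2)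
    (measurable_of_countable _) hm
  rw [← h, lintegral_countable', ENNReal.tsum_prod']
  refine tsum_congr fun i => tsum_congr fun j => ?_
  rw [Measure.map_apply hm (measurableSet_singleton _)]
  congr 2
  ext x
  simp only [Set.mem_preimage, Set.mem_singleton_iff, Prod.mk.injEq, cylSet, Set.mem_ofPred_eq,
    List.length_cons, List.length_nil]
  refine ⟨fun h i hi => ?_, fun h => ⟨by simpa using h 0, by simpa using h 1⟩⟩
  interval_cases i <;> simp [h]

/-- The mean of `φ` for the Gurevich–Markov measure at `t` is a subgradient of the pressure. -/
theorem IsGM.subgradient {A : ℕ → ℕ → Prop} {ψ : ℕ → ℕ → ℝ} {φ : MShift A → ℝ}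
    (hMarkov : ∀ x, φ x = ψ (x.seq 0) (x.seq 1)) {s t p q : ℝ} {μ ν : Measure (MShift A)}
    (hμ : IsGM A (fun u v => t * ψ u v) p μ) (hν : IsGM A (fun u v => s * ψ u v) q ν)
    (hint : Integrable φ μ) :
    (s - t) * ∫ x, φ x ∂μ ≤ q - p := by
  have := hμ.prob
  obtain ⟨h, g, hh, hg, -, -, hone, hcyl⟩ := hμ.eigen
  obtain ⟨-, g', -, hg', -, hright, -, -⟩ := hν.eigen
  let f : MShift A → ℝ := fun x => Real.log (g' (x.seq 0)) - Real.log (g (x.seq 0))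
  have hf : Measurable f :=
    (measurable_of_countable fun i => Real.log (g' i) - Real.log (g i)).comp
      (MShift.measurable_seq 0)
  let u : MShift A → ℝ := fun x => (s - t) * φ x - (q - p)
  have hφ : Measurable φ := by
    have : φ = (fun r : ℕ × ℕ => ψ r.1 r.2) ∘ fun x : MShift A => (x.seq 0, x.seq 1) :=
      funext hMarkov
    rw [this]
    exact (measurable_of_countable _).comp
      ((MShift.measurable_seq 0).prodMk (MShift.measurable_seq 1))
  have hum : Measurable u := by fun_prop
  have hu : Integrable u μ := (hint.const_mul _).sub (integrable_const _)
  let F : ℕ → ℕ → ℝ := fun i j => Real.exp ((s - t) * ψ i j - (q - p)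
    + (Real.log (g' j) - Real.log (g j) - (Real.log (g' i) - Real.log (g i))))
  have hterm : ∀ i j, ENNReal.ofReal (F i j) * μ (cylSet A [i, j]) ≤
      ENNReal.ofReal (h i * g i * (g' i)⁻¹ * Real.exp (-q)) *
        Set.indicator {b | A i b} (fun b => ENNReal.ofReal (Real.exp (s * ψ i b) * g' b)) j := by
    intro i j
    rcases (cylSet A [i, j]).eq_empty_or_nonempty with hem | hne
    · simp [hem]
    have hA : A i j := by
      obtain ⟨x, hx⟩ := hne
      have h0 : x.seq 0 = i := by simpa using hx 0
      have h1 : x.seq 1 = j := by simpa using hx 1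
      exact h0 ▸ h1 ▸ x.adm 0
    rw [Set.indicator_of_mem (show j ∈ {b | A i b} from hA),
      hcyl [i, j] (by simp) (List.isChain_pair.2 hA) hne,
      ← ENNReal.ofReal_mul (Real.exp_pos _).le,
      ← ENNReal.ofReal_mul (by have := hh i; have := hg i; have := hg' i; positivity)]
    refine ENNReal.ofReal_le_ofReal (le_of_eq ?_)
    have e : F i j = Real.exp (s * ψ i j) * (Real.exp (t * ψ i j - p))⁻¹ * Real.exp (-q)
        * (g' j * (g j)⁻¹ * ((g' i)⁻¹ * g i)) := by
      rw [← Real.exp_log (hg' j), ← Real.exp_log (hg j), ← Real.exp_log (hg' i),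
        ← Real.exp_log (hg i)]
      simp only [← Real.exp_neg, ← Real.exp_add, F]
      congr 1
      ring
    have w : pathWt (fun u v => t * ψ u v) [i, j] - (pathLen [i, j] : ℝ) * p
        = t * ψ i j - p := by simp [pathWt, pathLen]
    change F i j * _ = _
    rw [e, w]
    have := (Real.exp_pos (t * ψ i j - p)).ne'
    have := (hg j).ne'
    simp only [List.headI, List.getLastD_cons, List.getLastD_nil]
    field_simp
  have hexp : ∫⁻ x, ENNReal.ofReal (Real.exp (u x + (f (shiftMap A x) - f x))) ∂μ ≤ 1 := by
    have e : ∀ x, ENNReal.ofReal (Real.exp (u x + (f (shiftMap A x) - f x)))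
        = ENNReal.ofReal (F (x.seq 0) (x.seq 1)) := fun x => by
      simp only [u, f, F, hMarkov, shiftMap, zero_add]
    simp only [e]
    rw [lintegral_eq_tsum_cylSet μ fun i j => ENNReal.ofReal (F i j), ← hone]
    refine ENNReal.tsum_le_tsum fun i => (ENNReal.tsum_le_tsum (hterm i)).trans (le_of_eq ?_)
    have hr : ∑' j, Set.indicator {b | A i b}
        (fun b => ENNReal.ofReal (Real.exp (s * ψ i b) * g' b)) j
        = ENNReal.ofReal (Real.exp q * g' i) := by
      rw [← hright i, ← tsum_subtype]
      rfl
    have := (hg' i).ne'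
    rw [ENNReal.tsum_mul_left, hr,
      ← ENNReal.ofReal_mul (by have := hh i; have := hg i; have := hg' i; positivity),
      Real.exp_neg]
    congr 1
    field_simp
  have key := integral_nonpos_of_lintegral_exp_add_coboundary_le_one
    hμ.inv.measurePreserving hu hum hf hexp
  have hval : ∫ x, u x ∂μ = (s - t) * ∫ x, φ x ∂μ - (q - p) := by
    simp only [u]
    rw [integral_sub (hint.const_mul _) (integrable_const _), integral_const_mul]
    simp
  linarith

/-- For the Gurevich–Markov equilibrium states `(μ_t)`: the map
`t ↦ ∫φ dμ_t` is nondecreasing and the entropy `t ↦ P_G(tφ) − t·∫φ dμ_t` is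
nonincreasing. -/
theorem stmt4 (A : ℕ → ℕ → Prop) (hA : NoZeroRC A) (hTrans : TopTrans A)
    (ψ : ℕ → ℕ → ℝ) (φ : MShift A → ℝ) (hMarkov : ∀ x, φ x = ψ (x.seq 0) (x.seq 1))
    (hsum : SummablePot A φ) (V : ℝ) (hV : VarBdd A φ 1 V)
    (hfin : ∀ a : ℕ, PGur A φ a < ⊤)
    (P : ℝ → ℝ) (μ : ℝ → Measure (MShift A))
    (hP : ∀ t : ℝ, 1 ≤ t → IsPG A (fun x => t * φ x) ((P t : ℝ) : EReal))
    (hGM : ∀ t : ℝ, 1 ≤ t → IsGM A (fun u v => t * ψ u v) (P t) (μ t))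
    (hint : ∀ t : ℝ, 1 ≤ t → Integrable φ (μ t)) :
    ∀ t₁ t₂ : ℝ, 1 ≤ t₁ → t₁ < t₂ →
      (∫ x, φ x ∂(μ t₁)) ≤ (∫ x, φ x ∂(μ t₂)) ∧
      P t₂ - t₂ * ∫ x, φ x ∂(μ t₂) ≤ P t₁ - t₁ * ∫ x, φ x ∂(μ t₁) := by
  intro t₁ t₂ h₁ h₁₂
  have h₂ : 1 ≤ t₂ := h₁.trans h₁₂.le
  have hlow := (hGM t₁ h₁).subgradient hMarkov (hGM t₂ h₂) (hint t₁ h₁)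
  have hupp := (hGM t₂ h₂).subgradient hMarkov (hGM t₁ h₁) (hint t₂ h₂)
  have hmono : ∫ x, φ x ∂(μ t₁) ≤ ∫ x, φ x ∂(μ t₂) :=
    le_of_mul_le_mul_left (by linarith) (sub_pos.2 h₁₂)
  refine ⟨hmono, ?_⟩
  have := mul_le_mul_of_nonneg_left hmono (zero_le_one.trans h₁)
  linarith
end

section
/- Let Σ be a topologically transitive countable Markov shift and let φ : Σ → ℝ be a summable potential with Σ_{n≥1} Var_n(φ) < ∞ and P_G(φ) < ∞. Then for every t ≥ 1 the potential tφ is positive recurrent; that is, for every a ∈ ℕ: Σ_{n≥1} exp(−n·P_G(tφ))·Z_n(tφ, a) = ∞ and Σ_{n≥1} n·exp(−n·P_G(tφ))·Z_n^*(tφ, a) < ∞. -/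
open MeasureTheory Filter Topology BoundedContinuousFunction
open scoped ENNReal NNReal

/-! ## Sums of submultiplicative weights over words -/

section Words

variable {A : ℕ → ℕ → Prop} {C : ℝ≥0∞} {g : List ℕ → ℝ≥0∞}

/-- A finite weight on words which is submultiplicative under concatenation, and
supermultiplicative up to the constant `C` along admissible concatenations. -/
structure IsWordWeight (A : ℕ → ℕ → Prop) (C : ℝ≥0∞) (g : List ℕ → ℝ≥0∞) : Prop where
  const_ne_top : C ≠ ⊤
  nil : g [] = 1
  append_le : ∀ l l', g (l ++ l') ≤ g l * g l'
  le_append : ∀ l l', (l ++ l').IsChain A → g l * g l' ≤ C * g (l ++ l')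
  ne_zero : ∀ l, l.IsChain A → g l ≠ 0
  ne_top : ∀ l, g l ≠ ⊤

/-- The weight `g` twisted by the exponential of `u` times the length. -/
noncomputable def expWeight (g : List ℕ → ℝ≥0∞) (u : ℝ) (l : List ℕ) : ℝ≥0∞ :=
  g l * ENNReal.ofReal (Real.exp (u * l.length))

lemma IsWordWeight.expWeight (h : IsWordWeight A C g) (u : ℝ) :
    IsWordWeight A C (expWeight g u) := by
  have key : ∀ l l' : List ℕ, ENNReal.ofReal (Real.exp (u * (l ++ l').length)) =
      ENNReal.ofReal (Real.exp (u * l.length)) * ENNReal.ofReal (Real.exp (u * l'.length)) := by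
    intro l l'
    rw [← ENNReal.ofReal_mul (Real.exp_pos _).le, ← Real.exp_add, List.length_append]
    push_cast
    ring_nf
  refine ⟨h.const_ne_top, by simp [_root_.expWeight, h.nil], fun l l' => ?_, fun l l' hl => ?_,
    fun l hl => ?_, fun l => ENNReal.mul_ne_top (h.ne_top l) ENNReal.ofReal_ne_top⟩
  · unfold _root_.expWeight
    rw [key, mul_mul_mul_comm]
    gcongr
    exact h.append_le l l'
  · unfold _root_.expWeight
    rw [key, mul_mul_mul_comm, ← mul_assoc C]
    exact mul_le_mul_left (h.le_append l l' hl) _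
  · exact mul_ne_zero (h.ne_zero l hl) (by simpa using Real.exp_pos _)

/-- Admissible words without symbols in `J`. -/
def avoiding (A : ℕ → ℕ → Prop) (J : Finset ℕ) : Set (List ℕ) :=
  {l | l.IsChain A ∧ ∀ x ∈ l, x ∉ J}

/-- Words `l` without symbols in `J` such that `l` followed by `b` is an admissible word
starting at `b`; the empty word is allowed. -/
def loopsAt (A : ℕ → ℕ → Prop) (b : ℕ) (J : Finset ℕ) : Set (List ℕ) :=
  {l | (l ++ [b]).head? = some b ∧ (l ++ [b]).IsChain A ∧ ∀ x ∈ l, x ∉ J}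

/-- The words of `loopsAt A b J` with exactly `k` occurrences of `b`. -/
def loopsAtN (A : ℕ → ℕ → Prop) (b : ℕ) (J : Finset ℕ) (k : ℕ) : Set (List ℕ) :=
  {l | l ∈ loopsAt A b J ∧ l.count b = k}

lemma tsum_le_mul_of_append (h : IsWordWeight A C g) {S S₁ S₂ : Set (List ℕ)}
    (hS : ∀ l ∈ S, ∃ l₁ ∈ S₁, ∃ l₂ ∈ S₂, l = l₁ ++ l₂) :
    ∑' l : S, g l ≤ (∑' l : S₁, g l) * ∑' l : S₂, g l := by
  choose f₁ hf₁ f₂ hf₂ hf using hS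
  let F : S → S₁ × S₂ := fun l => (⟨f₁ l l.2, hf₁ l l.2⟩, ⟨f₂ l l.2, hf₂ l l.2⟩)
  have hF : Function.Injective F := by
    intro l l' hll
    simp only [F, Prod.mk.injEq, Subtype.mk.injEq] at hll
    exact Subtype.ext (by rw [hf l l.2, hf l' l'.2, hll.1, hll.2])
  calc ∑' l : S, g l ≤ ∑' l : S, (fun q : S₁ × S₂ => g q.1 * g q.2) (F l) := by
        refine ENNReal.tsum_le_tsum fun l => ?_
        conv_lhs => rw [hf l l.2]
        exact h.append_le _ _
    _ ≤ ∑' q : S₁ × S₂, g q.1 * g q.2 := ENNReal.tsum_comp_le_tsum_of_injective hF _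
    _ = (∑' l : S₁, g l) * ∑' l : S₂, g l := by
        rw [ENNReal.tsum_prod (f := fun (a : S₁) (b : S₂) => g a * g b), ← ENNReal.tsum_mul_right]
        simp_rw [ENNReal.tsum_mul_left]

lemma exists_split_count (b : ℕ) (l : List ℕ) (k : ℕ) (hk : k ≤ l.count b) :
    ∃ l₁ l₂, l = l₁ ++ l₂ ∧ l₁.count b = k ∧ (l₂ ++ [b]).head? = some b := by
  induction l generalizing k with
  | nil => exact ⟨[], [], by simp_all⟩
  | cons x l ih =>
    by_cases hx : x = b
    · subst hx
      cases k with
      | zero => exact ⟨[], x :: l, by simp⟩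
      | succ k =>
        obtain ⟨l₁, l₂, rfl, h₁, h₂⟩ := ih k (by simpa using hk)
        exact ⟨x :: l₁, l₂, by simp, by simp [h₁], h₂⟩
    · obtain ⟨l₁, l₂, rfl, h₁, h₂⟩ := ih k (by simpa [List.count_cons_of_ne hx] using hk)
      exact ⟨x :: l₁, l₂, by simp, by simp [List.count_cons_of_ne hx, h₁], h₂⟩

lemma exists_eq_cons_of_head? {l : List ℕ} {b : ℕ} (h : l.head? = some b) :
    ∃ t, l = b :: t := by
  cases l with
  | nil => simp at h
  | cons x t => exact ⟨t, by simp_all⟩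

lemma append_mem_loopsAt {b : ℕ} {J : Finset ℕ} {l₁ l₂ : List ℕ}
    (h₂ : (l₂ ++ [b]).head? = some b) :
    l₁ ++ l₂ ∈ loopsAt A b J ↔ l₁ ∈ loopsAt A b J ∧ l₂ ∈ loopsAt A b J := by
  obtain ⟨t, ht⟩ := exists_eq_cons_of_head? h₂
  have h₁ : (l₁ ++ l₂ ++ [b]).head? = (l₁ ++ [b]).head? := by
    rw [List.append_assoc, ht]
    cases l₁ <;> simp
  have h₃ : (l₁ ++ l₂ ++ [b]).IsChain A ↔ (l₁ ++ [b]).IsChain A ∧ (l₂ ++ [b]).IsChain A := by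
    rw [List.append_assoc, ht, List.isChain_split]
  simp only [loopsAt, Set.mem_ofPred_eq, h₁, h₂, h₃, List.mem_append]
  grind

lemma tsum_loopsAtN_add_le (h : IsWordWeight A C g) (b : ℕ) (J : Finset ℕ) (k m : ℕ) :
    ∑' l : loopsAtN A b J (k + m), g l ≤
      (∑' l : loopsAtN A b J k, g l) * ∑' l : loopsAtN A b J m, g l := by
  refine tsum_le_mul_of_append h ?_
  rintro l ⟨hl, hc⟩
  obtain ⟨l₁, l₂, rfl, h₁, h₂⟩ := exists_split_count b l k (by omega)
  rw [append_mem_loopsAt h₂] at hl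
  rw [List.count_append] at hc
  exact ⟨l₁, ⟨hl.1, h₁⟩, l₂, ⟨hl.2, by omega⟩, rfl⟩

lemma append_inj_of_count {b : ℕ} {l₁ l₂ l₁' l₂' : List ℕ} (h : l₁ ++ l₂ = l₁' ++ l₂')
    (hc : l₁.count b = l₁'.count b) (h₂ : (l₂ ++ [b]).head? = some b)
    (h₂' : (l₂' ++ [b]).head? = some b) : l₁ = l₁' ∧ l₂ = l₂' := by
  rcases List.append_eq_append_iff.1 h with ⟨t, rfl, rfl⟩ | ⟨t, rfl, rfl⟩ <;>
  · cases t with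
    | nil => simp
    | cons x t => simp_all

lemma tsum_loopsAtN_mul_le (h : IsWordWeight A C g) (b : ℕ) (J : Finset ℕ) (k m : ℕ) :
    (∑' l : loopsAtN A b J k, g l) * ∑' l : loopsAtN A b J m, g l ≤
      C * ∑' l : loopsAtN A b J (k + m), g l := by
  let F : loopsAtN A b J k × loopsAtN A b J m → loopsAtN A b J (k + m) := fun q =>
    ⟨q.1 ++ q.2, (append_mem_loopsAt q.2.2.1.1).2 ⟨q.1.2.1, q.2.2.1⟩, by
      rw [List.count_append, q.1.2.2, q.2.2.2]⟩
  have hF : Function.Injective F := by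
    rintro ⟨⟨l₁, h₁⟩, ⟨l₂, h₂⟩⟩ ⟨⟨l₁', h₁'⟩, ⟨l₂', h₂'⟩⟩ hq
    have := append_inj_of_count (congrArg Subtype.val hq) (h₁.2.trans h₁'.2.symm) h₂.1.1 h₂'.1.1
    simp_all
  calc _ = ∑' q : loopsAtN A b J k × loopsAtN A b J m, g q.1 * g q.2 := by
        rw [ENNReal.tsum_prod (f := fun (a : loopsAtN A b J k) (c : loopsAtN A b J m) =>
          g a * g c), ← ENNReal.tsum_mul_right]
        simp_rw [ENNReal.tsum_mul_left]
    _ ≤ ∑' q, C * g (F q) := by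
        refine ENNReal.tsum_le_tsum fun q => h.le_append _ _ ?_
        exact (F q).2.1.2.1.left_of_append
    _ ≤ C * ∑' l : loopsAtN A b J (k + m), g l := by
        rw [ENNReal.tsum_mul_left]
        gcongr
        exact ENNReal.tsum_comp_le_tsum_of_injective hF (fun l => g l)

lemma tsum_eq_tsum_fiber {S : Set (List ℕ)} (f : List ℕ → ℕ) :
    ∑' l : S, g l = ∑' k, ∑' l : {l | l ∈ S ∧ f l = k}, g l := by
  rw [← ENNReal.tsum_biUnion (f := g) (t := fun k => {l | l ∈ S ∧ f l = k})]
  · have : ⋃ k, {l | l ∈ S ∧ f l = k} = S := by ext; simp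
    rw [this]
  · intro i _ j _ hij
    exact Set.disjoint_left.2 fun l hi hj => hij (hi.2.symm.trans hj.2)

lemma tsum_loopsAt (b : ℕ) (J : Finset ℕ) :
    ∑' l : loopsAt A b J, g l = ∑' k, ∑' l : loopsAtN A b J k, g l :=
  tsum_eq_tsum_fiber _

lemma tsum_singleton_word (l : List ℕ) : ∑' x : ({l} : Set (List ℕ)), g x = g l :=
  tsum_singleton l g

lemma tsum_loopsAtN_zero_le (h : IsWordWeight A C g) (b : ℕ) (J : Finset ℕ) :
    ∑' l : loopsAtN A b J 0, g l ≤ 1 := by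
  rw [← h.nil, ← tsum_singleton_word (g := g) []]
  refine ENNReal.tsum_mono_subtype g ?_
  rintro (_ | ⟨x, l⟩) ⟨hl, hc⟩
  · rfl
  · simp_all [loopsAt]

lemma exists_cons_of_count_one {b : ℕ} {l : List ℕ} (h : (l ++ [b]).head? = some b)
    (hc : l.count b = 1) : ∃ t, l = b :: t ∧ b ∉ t := by
  cases l with
  | nil => simp at hc
  | cons x t =>
    obtain rfl : x = b := by simpa using h
    exact ⟨t, rfl, by simpa [List.count_eq_zero] using hc⟩

lemma tsum_loopsAtN_one_le (h : IsWordWeight A C g) (b : ℕ) (J : Finset ℕ) :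
    ∑' l : loopsAtN A b J 1, g l ≤ g [b] * ∑' l : avoiding A (insert b J), g l := by
  rw [← tsum_singleton_word (g := g) [b]]
  refine tsum_le_mul_of_append h ?_
  rintro l ⟨⟨hh, hch, hJ⟩, hc⟩
  obtain ⟨t, rfl, ht⟩ := exists_cons_of_count_one hh hc
  refine ⟨[b], rfl, t, ⟨hch.left_of_append.tail, fun x hx => ?_⟩, rfl⟩
  rw [Finset.mem_insert, not_or]
  exact ⟨fun hxb => ht (hxb ▸ hx), hJ x (List.mem_cons_of_mem _ hx)⟩

lemma tsum_avoiding_le (h : IsWordWeight A C g) (b : ℕ) (J : Finset ℕ) :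
    ∑' l : avoiding A J, g l ≤ ∑' l : avoiding A (insert b J), g l +
      (∑' l : avoiding A (insert b J), g l) * ((∑' l : loopsAt A b J, g l) *
        (g [b] * ∑' l : avoiding A (insert b J), g l)) := by
  let S₃ : Set (List ℕ) := {l | ∃ t ∈ avoiding A (insert b J), l = b :: t}
  let S₂ : Set (List ℕ) := {l | ∃ m ∈ loopsAt A b J, ∃ t ∈ S₃, l = m ++ t}
  let S₁ : Set (List ℕ) := {l | ∃ m ∈ avoiding A (insert b J), ∃ t ∈ S₂, l = m ++ t}
  have h₃ : ∑' l : S₃, g l ≤ g [b] * ∑' l : avoiding A (insert b J), g l := by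
    rw [← tsum_singleton_word (g := g) [b]]
    refine tsum_le_mul_of_append h ?_
    rintro l ⟨t, ht, rfl⟩
    exact ⟨[b], rfl, t, ht, rfl⟩
  have h₂ : ∑' l : S₂, g l ≤ (∑' l : loopsAt A b J, g l) * ∑' l : S₃, g l :=
    tsum_le_mul_of_append h fun l hl => hl
  have h₁ : ∑' l : S₁, g l ≤ (∑' l : avoiding A (insert b J), g l) * ∑' l : S₂, g l :=
    tsum_le_mul_of_append h fun l hl => hl
  have hsub : avoiding A J ⊆ avoiding A (insert b J) ∪ S₁ := by
    rintro l ⟨hch, hJ⟩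
    by_cases hb : b ∈ l
    · right
      obtain ⟨l₀, r, rfl, hc₀, hr⟩ := exists_split_count b l 0 (Nat.zero_le _)
      have hpos := List.count_pos_iff.2 hb
      rw [List.count_append, hc₀, zero_add] at hpos
      obtain ⟨m, r', rfl, hcm, hr'⟩ := exists_split_count b r (r.count b - 1) (Nat.sub_le _ _)
      rw [List.count_append] at hcm hpos
      obtain ⟨t, rfl, ht⟩ := exists_cons_of_count_one hr' (by omega)
      have hm : (m ++ [b]).head? = some b := by
        cases m with
        | nil => rfl
        | cons x m => simpa using hr
      have hrch : (m ++ b :: t).IsChain A := hch.right_of_append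
      rw [List.isChain_split] at hrch
      have hb₀ : b ∉ l₀ := List.count_eq_zero.1 hc₀
      refine ⟨l₀, ⟨hch.left_of_append, ?_⟩, m ++ b :: t,
        ⟨m, ⟨hm, hrch.1, ?_⟩, b :: t, ⟨t, ⟨hrch.2.tail, ?_⟩, rfl⟩, rfl⟩, rfl⟩
      all_goals grind
    · left
      exact ⟨hch, by grind⟩
  calc ∑' l : avoiding A J, g l ≤ ∑' l : ↑(avoiding A (insert b J) ∪ S₁), g l :=
        ENNReal.tsum_mono_subtype g hsub
    _ ≤ _ := ENNReal.tsum_union_le g _ _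
    _ ≤ _ := by
        gcongr
        refine h₁.trans ?_
        gcongr
        refine h₂.trans ?_
        gcongr

lemma take_append_inj_of_mem {a : ℕ} {d l₁ l₂ l₁' l₂' : List ℕ} (ha : a ∈ d)
    (h₁ : a ∉ l₁) (h₁' : a ∉ l₁') (h : l₁ ++ (d ++ l₂) = l₁' ++ (d ++ l₂')) :
    l₁ = l₁' ∧ l₂ = l₂' := by
  have hlen : l₁.length = l₁'.length := by
    have := congrArg (List.idxOf a) h
    rw [List.idxOf_append_of_notMem h₁, List.idxOf_append_of_notMem h₁',
      List.idxOf_append_of_mem ha, List.idxOf_append_of_mem ha] at this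
    omega
  obtain ⟨h₁, h₂⟩ := List.append_inj h hlen
  exact ⟨h₁, List.append_cancel_left h₂⟩

/-- Inserting a fixed loop `d` through a forbidden symbol at each of the `m` visits to `b`. -/
lemma mul_tsum_loopsAtN_le (h : IsWordWeight A C g) {a b : ℕ} {J : Finset ℕ} (haJ : a ∈ J)
    {d : List ℕ} (hd : d ∈ loopsAt A b ∅) (had : a ∈ d) (m : ℕ) :
    m * (g d * ∑' l : loopsAtN A b J m, g l) ≤
      C ^ 2 * ∑' l : loopsAtN A b ∅ (m + d.count b), g l := by
  have hsplit : ∀ (i : Fin m) (l : loopsAtN A b J m), ∃ l₁ l₂, (l : List ℕ) = l₁ ++ l₂ ∧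
      l₁.count b = i ∧ (l₂ ++ [b]).head? = some b := fun i l =>
    exists_split_count b l i (by rw [l.2.2]; exact i.2.le)
  choose f₁ f₂ hf hc hf₂ using hsplit
  have hmem : ∀ i l, f₁ i l ∈ loopsAt A b ∅ ∧ f₂ i l ∈ loopsAt A b ∅ := fun i l => by
    rw [← append_mem_loopsAt (hf₂ i l), ← hf i l]
    exact ⟨l.2.1.1, l.2.1.2.1, by simp⟩
  have hins : ∀ i l, f₁ i l ++ (d ++ f₂ i l) ∈ loopsAt A b ∅ := fun i l => by
    have h1 := (append_mem_loopsAt (hf₂ i l)).2 ⟨hd, (hmem i l).2⟩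
    exact (append_mem_loopsAt h1.1).2 ⟨(hmem i l).1, h1⟩
  let F : Fin m × loopsAtN A b J m → loopsAtN A b ∅ (m + d.count b) := fun q =>
    ⟨f₁ q.1 q.2 ++ (d ++ f₂ q.1 q.2), hins _ _, by
      have := q.2.2.2
      rw [hf q.1 q.2, List.count_append] at this
      rw [List.count_append, List.count_append]
      omega⟩
  have hF : Function.Injective F := by
    rintro ⟨i, l⟩ ⟨i', l'⟩ hq
    have hnot : ∀ i l, a ∉ f₁ i l := fun i l hal =>
      l.2.1.2.2 a (by rw [hf i l]; exact List.mem_append_left _ hal) haJ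
    obtain ⟨h1, h2⟩ := take_append_inj_of_mem had (hnot i l) (hnot i' l')
      (congrArg Subtype.val hq)
    have hi : i = i' := Fin.ext (by rw [← hc i l, ← hc i' l', h1])
    have hl : l = l' := Subtype.ext (by rw [hf i l, hf i' l', h1, h2])
    rw [hi, hl]
  have hle : ∀ i (l : loopsAtN A b J m), g d * g (l : List ℕ) ≤ C ^ 2 * g (f₁ i l ++ (d ++ f₂ i l)) := fun i l => by
    have hch : (f₁ i l ++ (d ++ f₂ i l)).IsChain A := (hins i l).2.1.left_of_append
    calc g d * g (l : List ℕ) ≤ g d * (g (f₁ i l) * g (f₂ i l)) := by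
          gcongr
          conv_lhs => rw [hf i l]
          exact h.append_le _ _
      _ = g (f₁ i l) * (g d * g (f₂ i l)) := by ring
      _ ≤ g (f₁ i l) * (C * g (d ++ f₂ i l)) := by
          exact mul_le_mul_right (h.le_append _ _ hch.right_of_append) _
      _ = C * (g (f₁ i l) * g (d ++ f₂ i l)) := by ring
      _ ≤ C * (C * g (f₁ i l ++ (d ++ f₂ i l))) := by
          exact mul_le_mul_right (h.le_append _ _ hch) _
      _ = _ := by ring
  calc m * (g d * ∑' l : loopsAtN A b J m, g l)
      = ∑' q : Fin m × loopsAtN A b J m, g d * g q.2 := by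
        rw [ENNReal.tsum_prod (f := fun (_ : Fin m) (l : loopsAtN A b J m) => g d * g l)]
        simp [ENNReal.tsum_mul_left]
    _ ≤ ∑' q, C ^ 2 * g (F q) := ENNReal.tsum_le_tsum fun q => hle q.1 q.2
    _ ≤ _ := by
        rw [ENNReal.tsum_mul_left]
        gcongr
        exact ENNReal.tsum_comp_le_tsum_of_injective hF (fun l => g l)

lemma tsum_ne_top_of_submul {B : ℕ → ℝ≥0∞} (hB : ∀ k m, B (k + m) ≤ B k * B m)
    (h0 : B 0 ≤ 1) (h1 : B 1 ≠ ⊤) {k : ℕ} (hk0 : k ≠ 0) (hk : B k < 1) : ∑' n, B n ≠ ⊤ := by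
  have hpow : ∀ j n, B (n * j) ≤ B j ^ n := by
    intro j n
    induction n with
    | zero => simpa using h0
    | succ n ih =>
      rw [Nat.succ_mul, pow_succ]
      exact (hB _ _).trans (mul_le_mul_left ih _)
  have hfin : ∀ n, B n ≠ ⊤ := fun n =>
    ne_top_of_le_ne_top (ENNReal.pow_ne_top h1) (by simpa using hpow 1 n)
  have : NeZero k := ⟨hk0⟩
  rw [← (Nat.divModEquiv k).symm.tsum_eq B]
  refine ne_top_of_le_ne_top (b := (1 - B k)⁻¹ * ∑ r : Fin k, B r) ?_ ?_
  · refine ENNReal.mul_ne_top ?_ (ENNReal.sum_ne_top.2 fun r _ => hfin r)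
    rw [ENNReal.inv_ne_top]
    exact (tsub_pos_of_lt hk).ne'
  · calc ∑' q : ℕ × Fin k, B ((Nat.divModEquiv k).symm q)
        ≤ ∑' q : ℕ × Fin k, B k ^ q.1 * B q.2 := by
          refine ENNReal.tsum_le_tsum fun q => ?_
          rw [Nat.divModEquiv_symm_apply]
          refine (hB _ _).trans (mul_le_mul_left ?_ _)
          exact hpow k q.1
      _ = (1 - B k)⁻¹ * ∑ r : Fin k, B r := by
          rw [ENNReal.tsum_prod (f := fun (a : ℕ) (r : Fin k) => B k ^ a * B r)]
          simp_rw [ENNReal.tsum_mul_left, ENNReal.tsum_mul_right, ENNReal.tsum_geometric,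
            tsum_fintype]

lemma expWeight_mono {u u' : ℝ} (h : u ≤ u') (l : List ℕ) : expWeight g u l ≤ expWeight g u' l := by
  unfold expWeight
  gcongr

lemma expWeight_convex {u₀ u₁ θ : ℝ} (h0 : 0 ≤ θ) (h1 : θ ≤ 1) (l : List ℕ) :
    expWeight g ((1 - θ) * u₀ + θ * u₁) l ≤
      ENNReal.ofReal (1 - θ) * expWeight g u₀ l + ENNReal.ofReal θ * expWeight g u₁ l := by
  unfold expWeight
  have hc := convexOn_exp.2 (Set.mem_univ (u₀ * l.length)) (Set.mem_univ (u₁ * l.length))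
    (sub_nonneg.2 h1) h0 (by ring)
  simp only [smul_eq_mul] at hc
  rw [mul_left_comm, mul_left_comm (ENNReal.ofReal θ), ← mul_add,
    ← ENNReal.ofReal_mul (sub_nonneg.2 h1), ← ENNReal.ofReal_mul h0,
    ← ENNReal.ofReal_add (by have := sub_nonneg.2 h1; positivity) (by positivity)]
  gcongr
  refine le_trans (le_of_eq ?_) hc
  ring_nf

lemma exists_gt_tsum_expWeight_lt_one {S : Set (List ℕ)} {u₀ u₁ : ℝ} (hu : u₀ < u₁)
    (h₀ : ∑' l : S, expWeight g u₀ l < 1) (h₁ : ∑' l : S, expWeight g u₁ l ≠ ⊤) :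
    ∃ u, u₀ < u ∧ u ≤ u₁ ∧ ∑' l : S, expWeight g u l < 1 := by
  obtain ⟨X, hX⟩ : ∃ X : ℝ≥0, (X : ℝ≥0∞) = _ := ⟨_, ENNReal.coe_toNNReal h₀.ne_top⟩
  obtain ⟨Y, hY⟩ : ∃ Y : ℝ≥0, (Y : ℝ≥0∞) = _ := ⟨_, ENNReal.coe_toNNReal h₁⟩
  have hX1 : (X : ℝ) < 1 := by
    rw [← hX] at h₀
    exact_mod_cast h₀
  have hX0 : (0 : ℝ) ≤ X := X.2
  have hY0 : (0 : ℝ) ≤ Y := Y.2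
  set θ : ℝ := (1 - X) / (2 * (Y + 1)) with hθ
  have hθ0 : 0 < θ := div_pos (by linarith) (by linarith)
  have hθY : θ * (Y + 1) = (1 - X) / 2 := by
    rw [hθ]
    field_simp
  have hθ1 : θ ≤ 1 := by nlinarith
  refine ⟨(1 - θ) * u₀ + θ * u₁, by nlinarith, by nlinarith, ?_⟩
  calc ∑' l : S, expWeight g ((1 - θ) * u₀ + θ * u₁) l
      ≤ ∑' l : S, (ENNReal.ofReal (1 - θ) * expWeight g u₀ l +
          ENNReal.ofReal θ * expWeight g u₁ l) :=
        ENNReal.tsum_le_tsum fun l => expWeight_convex hθ0.le hθ1 l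
    _ = ENNReal.ofReal (1 - θ) * X + ENNReal.ofReal θ * Y := by
        rw [ENNReal.tsum_add, ENNReal.tsum_mul_left, ENNReal.tsum_mul_left, hX, hY]
    _ = ENNReal.ofReal ((1 - θ) * X + θ * Y) := by
        rw [ENNReal.ofReal_add (mul_nonneg (by linarith) hX0) (by positivity),
          ENNReal.ofReal_mul (by linarith), ENNReal.ofReal_mul hθ0.le,
          ENNReal.ofReal_coe_nnreal, ENNReal.ofReal_coe_nnreal]
    _ < 1 := by
        rw [ENNReal.ofReal_lt_one]
        nlinarith

lemma exists_gt_tsum_loopsAt_ne_top (h : IsWordWeight A C g) {b : ℕ} {J : Finset ℕ}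
    {u₀ u₁ : ℝ} (hu : u₀ < u₁) (h₁ : ∑' l : loopsAtN A b J 1, expWeight g u₁ l ≠ ⊤)
    {k : ℕ} (hk0 : k ≠ 0) (hk : ∑' l : loopsAtN A b J k, expWeight g u₀ l < 1) :
    ∃ u, u₀ < u ∧ u ≤ u₁ ∧ ∑' l : loopsAt A b J, expWeight g u l ≠ ⊤ := by
  have hfin : ∀ n, ∑' l : loopsAtN A b J n, expWeight g u₁ l ≠ ⊤ := by
    intro n
    induction n with
    | zero =>
      exact ne_top_of_le_ne_top ENNReal.one_ne_top
        (tsum_loopsAtN_zero_le (h.expWeight u₁) b J)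
    | succ n ih =>
      exact ne_top_of_le_ne_top (ENNReal.mul_ne_top ih h₁)
        (tsum_loopsAtN_add_le (h.expWeight u₁) b J n 1)
  obtain ⟨u, hu₀, hu₁, hlt⟩ := exists_gt_tsum_expWeight_lt_one hu hk (hfin k)
  refine ⟨u, hu₀, hu₁, ?_⟩
  rw [tsum_loopsAt]
  refine tsum_ne_top_of_submul (tsum_loopsAtN_add_le (h.expWeight u) b J)
    (tsum_loopsAtN_zero_le (h.expWeight u) b J) ?_ hk0 hlt
  exact ne_top_of_le_ne_top h₁ (ENNReal.tsum_le_tsum fun l => expWeight_mono hu₁ l)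

lemma tsum_loopsAt_eq_top_of_lt (h : IsWordWeight A C g) {b : ℕ} {J : Finset ℕ} {N : ℕ}
    (hN : C < ∑' l : loopsAtN A b J N, g l) : ∑' l : loopsAt A b J, g l = ⊤ := by
  have hC : 1 ≤ C := by simpa [h.nil] using h.le_append [] [] (by simp)
  have hN0 : N ≠ 0 := by
    rintro rfl
    exact absurd hN (not_lt.2 ((tsum_loopsAtN_zero_le h b J).trans hC))
  set B : ℕ → ℝ≥0∞ := fun k => ∑' l : loopsAtN A b J k, g l with hBdef
  have hmono : ∀ m, B (N + m * N) ≤ B (N + (m + 1) * N) := by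
    intro m
    have h1 : B (N + m * N) * B N ≤ C * B (N + m * N + N) := tsum_loopsAtN_mul_le h b J _ _
    rw [show N + m * N + N = N + (m + 1) * N by ring] at h1
    have h2 : C * B (N + m * N) ≤ C * B (N + (m + 1) * N) :=
      le_trans (by rw [mul_comm]; exact mul_le_mul_right hN.le _) h1
    exact (ENNReal.mul_le_mul_iff_right (by positivity) h.const_ne_top).1 h2
  have hle : ∀ m, B N ≤ B (N + m * N) := by
    intro m
    induction m with
    | zero => simp
    | succ m ih => exact ih.trans (hmono m)
  have hinj : Function.Injective fun m : ℕ => N + m * N := fun i j hij => by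
    simpa [hN0] using hij
  rw [tsum_loopsAt, eq_top_iff]
  calc ⊤ = ∑' _ : ℕ, B N :=
        (ENNReal.tsum_const_eq_top_of_ne_zero (ne_of_gt (lt_of_le_of_lt zero_le hN))).symm
    _ ≤ ∑' m, B (N + m * N) := ENNReal.tsum_le_tsum hle
    _ ≤ ∑' k, B k := ENNReal.tsum_comp_le_tsum_of_injective hinj B

lemma continuous_expWeight {l : List ℕ} (hl : g l ≠ ⊤) : Continuous fun u => expWeight g u l := by
  unfold expWeight
  exact (ENNReal.continuous_const_mul hl).comp (ENNReal.continuous_ofReal.comp (by fun_prop))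

lemma exists_lt_tsum_loopsAt_eq_top (h : IsWordWeight A C g) {b : ℕ} {J : Finset ℕ} {N : ℕ}
    {u₀ : ℝ} (hN : C < ∑' l : loopsAtN A b J N, expWeight g u₀ l) :
    ∃ u < u₀, ∑' l : loopsAt A b J, expWeight g u l = ⊤ := by
  rw [ENNReal.tsum_eq_iSup_sum, lt_iSup_iff] at hN
  obtain ⟨s, hs⟩ := hN
  have hcont : Continuous fun u => ∑ l ∈ s, expWeight g u l :=
    continuous_finsetSum _ fun l _ => continuous_expWeight (h.ne_top l)
  have hev : ∀ᶠ u in 𝓝[<] u₀, C < ∑ l ∈ s, expWeight g u l :=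
    (hcont.continuousAt.eventually (lt_mem_nhds hs)).filter_mono nhdsWithin_le_nhds
  obtain ⟨u, hu, huC⟩ := ((eventually_mem_nhdsWithin (a := u₀) (s := Set.Iio u₀)).and hev).exists
  exact ⟨u, hu, tsum_loopsAt_eq_top_of_lt (h.expWeight u) (huC.trans_le (ENNReal.sum_le_tsum s))⟩

/-- Any two symbols are joined by an admissible word. -/
def WordTransitive (A : ℕ → ℕ → Prop) : Prop :=
  ∀ a b : ℕ, ∃ l : List ℕ, l.head? = some a ∧ (l ++ [b]).IsChain A

lemma WordTransitive.exists_loop (hA : WordTransitive A) (a b : ℕ) :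
    ∃ d ∈ loopsAt A b ∅, a ∈ d := by
  obtain ⟨l₁, h₁, hc₁⟩ := hA b a
  obtain ⟨l₂, h₂, hc₂⟩ := hA a b
  obtain ⟨t₁, rfl⟩ := exists_eq_cons_of_head? h₁
  obtain ⟨t₂, rfl⟩ := exists_eq_cons_of_head? h₂
  refine ⟨(b :: t₁) ++ (a :: t₂), ⟨by simp, ?_, by simp⟩, by simp⟩
  rw [List.append_assoc]
  exact List.isChain_split.2 ⟨hc₁, hc₂⟩

lemma exists_gt_tsum_avoiding_ne_top_of_insert (h : IsWordWeight A C g) (hA : WordTransitive A)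
    {u₀ : ℝ} {b : ℕ} (hp : ∀ u < u₀, ∑' l : loopsAt A b ∅, expWeight g u l ≠ ⊤)
    {J : Finset ℕ} (hJ : J.Nonempty)
    (h₁ : ∃ u, u₀ < u ∧ ∑' l : avoiding A (insert b J), expWeight g u l ≠ ⊤) :
    ∃ u, u₀ < u ∧ ∑' l : avoiding A J, expWeight g u l ≠ ⊤ := by
  obtain ⟨u₁, hu₁, h₁⟩ := h₁
  obtain ⟨a, ha⟩ := hJ
  by_cases hex : ∃ k ≠ 0, ∑' l : loopsAtN A b J k, expWeight g u₀ l < 1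
  · obtain ⟨k, hk0, hk⟩ := hex
    have hone : ∑' l : loopsAtN A b J 1, expWeight g u₁ l ≠ ⊤ :=
      ne_top_of_le_ne_top (ENNReal.mul_ne_top ((h.expWeight u₁).ne_top _) h₁)
        (tsum_loopsAtN_one_le (h.expWeight u₁) b J)
    obtain ⟨u, hu, huu, hfin⟩ := exists_gt_tsum_loopsAt_ne_top h hu₁ hone hk0 hk
    have hins : ∑' l : avoiding A (insert b J), expWeight g u l ≠ ⊤ :=
      ne_top_of_le_ne_top h₁ (ENNReal.tsum_le_tsum fun l => expWeight_mono huu l)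
    refine ⟨u, hu, ne_top_of_le_ne_top ?_ (tsum_avoiding_le (h.expWeight u) b J)⟩
    exact ENNReal.add_ne_top.2 ⟨hins, ENNReal.mul_ne_top hins (ENNReal.mul_ne_top hfin
      (ENNReal.mul_ne_top ((h.expWeight u).ne_top _) hins))⟩
  · push Not at hex
    exfalso
    obtain ⟨d, hd, had⟩ := hA.exists_loop a b
    have hw := h.expWeight u₀
    have hle : ∀ N, ∑' l : loopsAtN A b ∅ N, expWeight g u₀ l ≤ C := by
      intro N
      by_contra! hN
      obtain ⟨u, hu, htop⟩ := exists_lt_tsum_loopsAt_eq_top h hN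
      exact hp u hu htop
    obtain ⟨m, hm⟩ := ENNReal.exists_nat_mul_gt (hw.ne_zero d hd.2.1.left_of_append)
      (ENNReal.mul_ne_top (ENNReal.pow_ne_top (n := 2) h.const_ne_top) h.const_ne_top)
    rcases Nat.eq_zero_or_pos m with rfl | hm0
    · simp at hm
    refine absurd hm (not_lt.2 ?_)
    calc m * expWeight g u₀ d
        ≤ m * (expWeight g u₀ d * ∑' l : loopsAtN A b J m, expWeight g u₀ l) := by
          gcongr
          exact le_mul_of_one_le_right' (hex m hm0.ne')
      _ ≤ _ := mul_tsum_loopsAtN_le hw ha hd had m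
      _ ≤ C ^ 2 * C := by
          gcongr
          exact hle _

lemma exists_gt_tsum_avoiding_ne_top_of_union (h : IsWordWeight A C g) (hA : WordTransitive A)
    {u₀ : ℝ} (hp : ∀ b, ∀ u < u₀, ∑' l : loopsAt A b ∅, expWeight g u l ≠ ⊤)
    {J : Finset ℕ} (hJ : J.Nonempty) (K : Finset ℕ)
    (h₁ : ∃ u, u₀ < u ∧ ∑' l : avoiding A (K ∪ J), expWeight g u l ≠ ⊤) :
    ∃ u, u₀ < u ∧ ∑' l : avoiding A J, expWeight g u l ≠ ⊤ := by
  induction K using Finset.induction_on with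
  | empty => rwa [Finset.empty_union] at h₁
  | insert b K _ ih =>
    rw [Finset.insert_union] at h₁
    exact ih (exists_gt_tsum_avoiding_ne_top_of_insert h hA (hp b)
      (hJ.mono Finset.subset_union_right) h₁)

lemma tsum_avoiding_length_le (h : IsWordWeight A C g) (K : Finset ℕ) (n : ℕ) :
    ∑' l : {l | l ∈ avoiding A K ∧ l.length = n}, g l ≤ (∑' i : {i // i ∉ K}, g [i]) ^ n := by
  induction n with
  | zero =>
    rw [pow_zero, ← h.nil, ← tsum_singleton_word (g := g) []]
    exact ENNReal.tsum_mono_subtype g fun l hl => List.length_eq_zero_iff.1 hl.2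
  | succ n ih =>
    let F : {i // i ∉ K} → List ℕ := fun i => [i.1]
    have hF : Function.Injective F := fun i j hij => Subtype.ext (by simpa [F] using hij)
    have hr : ∑' l : Set.range F, g l = ∑' i : {i // i ∉ K}, g [i] := tsum_range g hF
    rw [pow_succ']
    nth_rw 1 [← hr]
    refine (tsum_le_mul_of_append h (S₁ := Set.range F)
      (S₂ := {l | l ∈ avoiding A K ∧ l.length = n}) ?_).trans (mul_le_mul_right ih _)
    rintro (_ | ⟨x, l⟩) ⟨⟨hch, hK⟩, hlen⟩
    · simp at hlen
    · exact ⟨[x], ⟨⟨x, hK x (by simp)⟩, rfl⟩, l,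
        ⟨⟨hch.tail, fun y hy => hK y (List.mem_cons_of_mem _ hy)⟩, by simpa using hlen⟩, rfl⟩

lemma exists_tsum_avoiding_ne_top (h : IsWordWeight A C g) (hs : ∑' i, g [i] ≠ ⊤) (a : ℕ) :
    ∃ K : Finset ℕ, ∑' l : avoiding A (K ∪ {a}), g l ≠ ⊤ := by
  obtain ⟨K, hK⟩ := ((ENNReal.tendsto_tsum_compl_atTop_zero hs).eventually
    (gt_mem_nhds one_pos)).exists
  refine ⟨K, ?_⟩
  have hlt : ∑' i : {i // i ∉ K ∪ {a}}, g [i] < 1 :=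
    lt_of_le_of_lt (ENNReal.tsum_mono_subtype (fun i => g [i])
      (s := {i | i ∉ K ∪ {a}}) (t := {i | i ∉ K}) fun i hi => by
        simp only [Set.mem_ofPred_eq, Finset.mem_union, not_or] at hi ⊢
        exact hi.1) hK
  rw [tsum_eq_tsum_fiber List.length]
  refine ne_top_of_le_ne_top ?_ (ENNReal.tsum_le_tsum fun n => tsum_avoiding_length_le h _ n)
  rw [ENNReal.tsum_geometric, ENNReal.inv_ne_top]
  exact (tsub_pos_of_lt hlt).ne'

lemma exists_gt_tsum_avoiding_singleton_ne_top (h : IsWordWeight A C g) (hA : WordTransitive A)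
    (hs : ∑' i, g [i] ≠ ⊤) {u₀ : ℝ}
    (hp : ∀ b, ∀ u < u₀, ∑' l : loopsAt A b ∅, expWeight g u l ≠ ⊤) (a : ℕ) :
    ∃ u, u₀ < u ∧ ∑' l : avoiding A {a}, expWeight g u l ≠ ⊤ := by
  have hs' : ∑' i, expWeight g (u₀ + 1) [i] ≠ ⊤ := by
    simp only [expWeight, List.length_singleton, ENNReal.tsum_mul_right]
    exact ENNReal.mul_ne_top hs ENNReal.ofReal_ne_top
  obtain ⟨K, hK⟩ := exists_tsum_avoiding_ne_top (h.expWeight (u₀ + 1)) hs' a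
  exact exists_gt_tsum_avoiding_ne_top_of_union h hA hp (Finset.singleton_nonempty a) K
    ⟨u₀ + 1, by linarith, hK⟩

lemma tsum_loopsAt_eq_top (h : IsWordWeight A C g) {u₀ : ℝ} {a : ℕ}
    (hp : ∀ u > u₀, ∑' l : loopsAt A a ∅, expWeight g u l = ⊤)
    (h₁ : ∃ u, u₀ < u ∧ ∑' l : avoiding A {a}, expWeight g u l ≠ ⊤) :
    ∑' l : loopsAt A a ∅, expWeight g u₀ l = ⊤ := by
  obtain ⟨u₁, hu₁, h₁⟩ := h₁
  by_cases hex : ∃ k ≠ 0, ∑' l : loopsAtN A a ∅ k, expWeight g u₀ l < 1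
  · obtain ⟨k, hk0, hk⟩ := hex
    have hone : ∑' l : loopsAtN A a ∅ 1, expWeight g u₁ l ≠ ⊤ :=
      ne_top_of_le_ne_top (ENNReal.mul_ne_top ((h.expWeight u₁).ne_top _) h₁)
        (tsum_loopsAtN_one_le (h.expWeight u₁) a ∅)
    obtain ⟨u, hu, -, hfin⟩ := exists_gt_tsum_loopsAt_ne_top h hu₁ hone hk0 hk
    exact absurd (hp u hu) hfin
  · push Not at hex
    rw [tsum_loopsAt, eq_top_iff, ← ENNReal.tsum_const_eq_top_of_ne_zero (α := ℕ) one_ne_zero]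
    exact (ENNReal.tsum_le_tsum fun k => hex (k + 1) k.succ_ne_zero).trans
      (ENNReal.tsum_comp_le_tsum_of_injective (add_left_injective 1)
        fun k => ∑' l : loopsAtN A a ∅ k, expWeight g u₀ l)

end Words

/-! ## Word weights of a potential with summable variations -/

section Shift

variable {A : ℕ → ℕ → Prop} {φ : MShift A → ℝ}

lemma MShift.ext_seq {x y : MShift A} (h : ∀ i, x.seq i = y.seq i) : x = y := by
  cases x
  cases y
  congr
  exact funext h

lemma shiftMap_iterate_seq (n i : ℕ) (x : MShift A) :
    ((shiftMap A)^[n] x).seq i = x.seq (i + n) := by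
  induction n generalizing x with
  | zero => rfl
  | succ n ih =>
    rw [Function.iterate_succ_apply, ih]
    exact congrArg x.seq (by omega)

lemma mem_cylSet_append {l l' : List ℕ} {x : MShift A} :
    x ∈ cylSet A (l ++ l') ↔ x ∈ cylSet A l ∧ (shiftMap A)^[l.length] x ∈ cylSet A l' := by
  simp only [cylSet, Set.mem_ofPred_eq, shiftMap_iterate_seq]
  constructor
  · intro h
    refine ⟨fun i hi => ?_, fun i hi => ?_⟩
    · rw [h i (by simp; omega), List.getD_append _ _ _ _ hi]
    · rw [h (i + l.length) (by simp; omega), List.getD_append_right _ _ _ _ (by omega),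
        Nat.add_sub_cancel]
  · rintro ⟨h₁, h₂⟩ i hi
    rcases lt_or_ge i l.length with hil | hil
    · rw [h₁ i hil, List.getD_append _ _ _ _ hil]
    · rw [List.getD_append_right _ _ _ _ hil, ← h₂ _ (by simp at hi; omega),
        Nat.sub_add_cancel hil]

lemma exists_seq_zero_eq (hA : NoZeroRC A) (a : ℕ) : ∃ x : MShift A, x.seq 0 = a := by
  choose f hf using fun i => (hA i).1
  exact ⟨⟨fun n => f^[n] a, fun i => by
    rw [Function.iterate_succ_apply']
    exact hf _⟩, rfl⟩

lemma cylSet_nonempty (hA : NoZeroRC A) {l : List ℕ} (hl : l.IsChain A) :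
    (cylSet A l).Nonempty := by
  induction l with
  | nil =>
    obtain ⟨x, -⟩ := exists_seq_zero_eq hA 0
    exact ⟨x, by simp [cylSet]⟩
  | cons i l ih =>
    obtain ⟨x, hx, hi⟩ : ∃ x ∈ cylSet A l, A i (x.seq 0) := by
      cases l with
      | nil =>
        obtain ⟨j, hj⟩ := (hA i).1
        obtain ⟨x, rfl⟩ := exists_seq_zero_eq hA j
        exact ⟨x, by simp [cylSet], hj⟩
      | cons j l =>
        obtain ⟨x, hx⟩ := ih hl.tail
        refine ⟨x, hx, ?_⟩
        rw [hx 0 (by simp)]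
        exact (List.isChain_cons_cons.1 hl).1
    refine ⟨⟨fun n => Nat.casesOn n i x.seq, fun n => ?_⟩, fun n hn => ?_⟩
    · cases n with
      | zero => exact hi
      | succ n => exact x.adm n
    · cases n with
      | zero => rfl
      | succ n => simpa using hx n (by simpa using hn)

lemma birkhoff_add (n m : ℕ) (x : MShift A) :
    birkhoff A φ (n + m) x = birkhoff A φ n x + birkhoff A φ m ((shiftMap A)^[n] x) :=
  birkhoffSum_add (shiftMap A) φ n m x

lemma abs_birkhoff_sub_le {V : ℕ → ℝ} (hVsum : Summable V)
    (hV : ∀ n : ℕ, 1 ≤ n → VarBdd A φ n (V n)) {n : ℕ} {x y : MShift A}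
    (h : ∀ i < n, x.seq i = y.seq i) :
    |birkhoff A φ n x - birkhoff A φ n y| ≤ ∑' k, |V k| := by
  calc |birkhoff A φ n x - birkhoff A φ n y|
      ≤ ∑ i ∈ Finset.range n, |φ ((shiftMap A)^[i] x) - φ ((shiftMap A)^[i] y)| := by
        rw [birkhoff, birkhoff, ← Finset.sum_sub_distrib]
        exact Finset.abs_sum_le_sum_abs _ _
    _ ≤ ∑ i ∈ Finset.range n, |V (n - 1 - i + 1)| := by
        refine Finset.sum_le_sum fun i hi => ?_
        rw [Finset.mem_range] at hi
        refine (hV (n - 1 - i + 1) (by omega) _ _ fun j hj => ?_).trans (le_abs_self _)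
        rw [shiftMap_iterate_seq, shiftMap_iterate_seq]
        exact h _ (by omega)
    _ = ∑ i ∈ Finset.range n, |V (i + 1)| :=
        Finset.sum_range_reflect (fun i => |V (i + 1)|) n
    _ ≤ ∑ i ∈ Finset.range (n + 1), |V i| := by
        rw [Finset.sum_range_succ' (fun i => |V i|)]
        exact le_add_of_nonneg_right (abs_nonneg _)
    _ ≤ ∑' k, |V k| := hVsum.abs.sum_le_tsum _ fun _ _ => abs_nonneg _

/-- The supremum of `exp (Sₙφ)` over the cylinder of a word of length `n`. -/
noncomputable def cylWeight (A : ℕ → ℕ → Prop) (φ : MShift A → ℝ) (l : List ℕ) : ℝ≥0∞ :=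
  ⨆ x : cylSet A l, ENNReal.ofReal (Real.exp (birkhoff A φ l.length x))

lemma le_cylWeight {l : List ℕ} {x : MShift A} (hx : x ∈ cylSet A l) :
    ENNReal.ofReal (Real.exp (birkhoff A φ l.length x)) ≤ cylWeight A φ l :=
  le_iSup (fun y : cylSet A l => ENNReal.ofReal (Real.exp (birkhoff A φ l.length y))) ⟨x, hx⟩

lemma cylWeight_le {V : ℕ → ℝ} (hVsum : Summable V)
    (hV : ∀ n : ℕ, 1 ≤ n → VarBdd A φ n (V n)) {l : List ℕ} {x : MShift A}
    (hx : x ∈ cylSet A l) :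
    cylWeight A φ l ≤ ENNReal.ofReal (Real.exp (∑' k, |V k|)) *
      ENNReal.ofReal (Real.exp (birkhoff A φ l.length x)) := by
  refine iSup_le fun y => ?_
  rw [← ENNReal.ofReal_mul (Real.exp_pos _).le, ← Real.exp_add]
  gcongr
  have := abs_birkhoff_sub_le hVsum hV (x := y.1) (y := x)
    fun i hi => (y.2 i hi).trans (hx i hi).symm
  linarith [le_abs_self (birkhoff A φ l.length y.1 - birkhoff A φ l.length x)]

lemma ofReal_exp_birkhoff_append (l l' : List ℕ) (x : MShift A) :
    ENNReal.ofReal (Real.exp (birkhoff A φ (l ++ l').length x)) =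
      ENNReal.ofReal (Real.exp (birkhoff A φ l.length x)) *
        ENNReal.ofReal (Real.exp (birkhoff A φ l'.length ((shiftMap A)^[l.length] x))) := by
  rw [← ENNReal.ofReal_mul (Real.exp_pos _).le, ← Real.exp_add, List.length_append, birkhoff_add]

lemma isWordWeight_cylWeight (hA : NoZeroRC A) {V : ℕ → ℝ} (hVsum : Summable V)
    (hV : ∀ n : ℕ, 1 ≤ n → VarBdd A φ n (V n)) :
    IsWordWeight A (ENNReal.ofReal (Real.exp (∑' k, |V k|)) ^ 2) (cylWeight A φ) where
  const_ne_top := ENNReal.pow_ne_top ENNReal.ofReal_ne_top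
  nil := by
    obtain ⟨x₀, hx₀⟩ := cylSet_nonempty hA List.IsChain.nil
    have : Nonempty (cylSet A []) := ⟨⟨x₀, hx₀⟩⟩
    simp [cylWeight, birkhoff]
  append_le l l' := by
    refine iSup_le fun x => ?_
    have hx := mem_cylSet_append.1 x.2
    rw [ofReal_exp_birkhoff_append]
    exact mul_le_mul' (le_cylWeight hx.1) (le_cylWeight hx.2)
  le_append l l' hl := by
    obtain ⟨x, hxl⟩ := cylSet_nonempty hA hl
    have hx := mem_cylSet_append.1 hxl
    refine (mul_le_mul' (cylWeight_le hVsum hV hx.1) (cylWeight_le hVsum hV hx.2)).trans ?_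
    rw [mul_mul_mul_comm, ← ofReal_exp_birkhoff_append, ← sq]
    exact mul_le_mul_right (le_cylWeight hxl) _
  ne_zero l hl := by
    obtain ⟨x, hx⟩ := cylSet_nonempty hA hl
    exact ne_of_gt (lt_of_lt_of_le (ENNReal.ofReal_pos.2 (Real.exp_pos _)) (le_cylWeight hx))
  ne_top l := by
    rcases (cylSet A l).eq_empty_or_nonempty with he | ⟨x, hx⟩
    · have : IsEmpty (cylSet A l) := Set.isEmpty_coe_sort.2 he
      simp [cylWeight]
    · exact ne_top_of_le_ne_top (ENNReal.mul_ne_top ENNReal.ofReal_ne_top ENNReal.ofReal_ne_top)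
        (cylWeight_le hVsum hV hx)

lemma tsum_cylWeight_singleton_ne_top (hsum : SummablePot A φ) :
    ∑' i, cylWeight A φ [i] ≠ ⊤ := by
  obtain ⟨s, hs, hφ⟩ := hsum
  refine ne_top_of_le_ne_top (b := ∑' i, ENNReal.ofReal (Real.exp (s i))) ?_ ?_
  · rw [← ENNReal.ofReal_tsum_of_nonneg (fun i => (Real.exp_pos _).le) hs]
    exact ENNReal.ofReal_ne_top
  · refine ENNReal.tsum_le_tsum fun i => iSup_le fun x => ?_
    gcongr
    simpa [birkhoff] using hφ i x (by simpa using x.2 0 (by simp))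

/-- The word of the first `n` symbols of a point. -/
def firstSymbols (x : MShift A) (n : ℕ) : List ℕ := (List.range n).map x.seq

lemma length_firstSymbols (x : MShift A) (n : ℕ) : (firstSymbols x n).length = n := by
  simp [firstSymbols]

lemma mem_cylSet_firstSymbols (x : MShift A) (n : ℕ) : x ∈ cylSet A (firstSymbols x n) := by
  intro i hi
  rw [length_firstSymbols] at hi
  simp [firstSymbols, hi]

lemma isChain_firstSymbols (x : MShift A) (n : ℕ) : (firstSymbols x n).IsChain A := by
  rw [List.isChain_iff_getElem]
  intro i hi
  simpa [firstSymbols] using x.adm i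

lemma firstSymbols_mem_loopsAt (x : MShift A) {n : ℕ} (hx : (shiftMap A)^[n] x = x) :
    firstSymbols x n ∈ loopsAt A (x.seq 0) ∅ := by
  have hn : x.seq n = x.seq 0 := by
    conv_rhs => rw [← hx, shiftMap_iterate_seq, zero_add]
  have key : firstSymbols x n ++ [x.seq 0] = firstSymbols x (n + 1) := by
    simp [firstSymbols, List.range_succ, hn]
  refine ⟨?_, ?_, by simp⟩
  · rw [key]
    simp [firstSymbols, List.range_succ_eq_map]
  · rw [key]
    exact isChain_firstSymbols x _

lemma seq_eq_seq_mod {x : MShift A} {n : ℕ} (hx : (shiftMap A)^[n] x = x) (i : ℕ) :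
    x.seq i = x.seq (i % n) := by
  have hper : Function.Periodic x.seq n := fun j => by
    rw [← shiftMap_iterate_seq n j x, hx]
  exact (hper.map_mod_nat i).symm

lemma eq_of_firstSymbols_eq {n : ℕ} (hn : n ≠ 0) {x y : MShift A}
    (hx : (shiftMap A)^[n] x = x) (hy : (shiftMap A)^[n] y = y)
    (h : firstSymbols x n = firstSymbols y n) : x = y := by
  refine MShift.ext_seq fun i => ?_
  have hi : i % n < n := Nat.mod_lt _ (Nat.pos_of_ne_zero hn)
  rw [seq_eq_seq_mod hx, seq_eq_seq_mod hy]
  have h₁ := mem_cylSet_firstSymbols x n (i % n) (by rwa [length_firstSymbols])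
  have h₂ := mem_cylSet_firstSymbols y n (i % n) (by rwa [length_firstSymbols])
  rw [h₁, h₂, h]

lemma tsum_periodic_le {n : ℕ} (hn : n ≠ 0) {P : MShift A → Prop} {S : Set (List ℕ)}
    (hS : ∀ x, (shiftMap A)^[n] x = x → P x → firstSymbols x n ∈ S) :
    ∑' x : {x : MShift A // (shiftMap A)^[n] x = x ∧ P x},
      ENNReal.ofReal (Real.exp (birkhoff A φ n x.1)) ≤
      ∑' l : {l | l ∈ S ∧ l.length = n}, cylWeight A φ l := by
  let F : {x : MShift A // (shiftMap A)^[n] x = x ∧ P x} → {l | l ∈ S ∧ l.length = n} :=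
    fun x => ⟨firstSymbols x.1 n, hS x.1 x.2.1 x.2.2, length_firstSymbols _ _⟩
  have hF : Function.Injective F := fun x y hxy =>
    Subtype.ext (eq_of_firstSymbols_eq hn x.2.1 y.2.1 (congrArg Subtype.val hxy))
  refine le_trans (ENNReal.tsum_le_tsum fun x => ?_)
    (ENNReal.tsum_comp_le_tsum_of_injective hF fun l => cylWeight A φ l)
  have := le_cylWeight (φ := φ) (mem_cylSet_firstSymbols x.1 n)
  rwa [length_firstSymbols] at this

lemma exists_periodic_of_mem_loopsAt {a : ℕ} {l : List ℕ} (hl : l ∈ loopsAt A a ∅)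
    (hl0 : l ≠ []) :
    ∃ x ∈ cylSet A l, (shiftMap A)^[l.length] x = x ∧ x.seq 0 = a := by
  obtain ⟨t, rfl⟩ : ∃ t, l = a :: t := by
    cases l with
    | nil => exact absurd rfl hl0
    | cons x t => exact ⟨t, by simpa using hl.1⟩
  obtain ⟨n, hn⟩ : ∃ n, (a :: t).length = n := ⟨_, rfl⟩
  have hpos : 0 < n := by simp [← hn]
  rw [hn]
  have hadm : ∀ i, A ((a :: t).getD (i % n) 0) ((a :: t).getD ((i + 1) % n) 0) := by
    intro i
    have hi : i % n < (a :: t).length := by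
      rw [hn]
      exact Nat.mod_lt _ hpos
    have hch := List.isChain_iff_getElem.1 hl.2.1 (i % n)
      (by rw [List.length_append, List.length_singleton]; omega)
    rw [List.getElem_append_left hi] at hch
    rw [List.getD_eq_getElem _ _ hi]
    convert hch using 1
    rcases Nat.lt_or_ge (i % n + 1) n with h | h
    · have hmod : (i + 1) % n = i % n + 1 := by
        rw [← Nat.mod_add_mod, Nat.mod_eq_of_lt h]
      rw [List.getElem_append_left (hn ▸ h), hmod, List.getD_eq_getElem]
    · have hin : i % n + 1 = n := le_antisymm (hn ▸ hi) h
      have hmod : (i + 1) % n = 0 := by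
        rw [← Nat.mod_add_mod, hin, Nat.mod_self]
      rw [List.getElem_append_right (by omega), hmod]
      simp
  refine ⟨⟨fun i => (a :: t).getD (i % n) 0, hadm⟩, fun i hi => ?_,
    MShift.ext_seq fun i => ?_, by simp⟩
  · rw [hn] at hi
    change (a :: t).getD (i % n) 0 = _
    rw [Nat.mod_eq_of_lt hi]
  · rw [shiftMap_iterate_seq]
    simp

lemma tsum_loopsAt_length_le {V : ℕ → ℝ} (hVsum : Summable V)
    (hV : ∀ n : ℕ, 1 ≤ n → VarBdd A φ n (V n)) {n : ℕ} (hn : n ≠ 0) (a : ℕ) :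
    ∑' l : {l | l ∈ loopsAt A a ∅ ∧ l.length = n}, cylWeight A φ l ≤
      ENNReal.ofReal (Real.exp (∑' k, |V k|)) * Zpart A φ n a := by
  have hex : ∀ l : {l | l ∈ loopsAt A a ∅ ∧ l.length = n}, ∃ x ∈ cylSet A (l : List ℕ),
      (shiftMap A)^[n] x = x ∧ x.seq 0 = a := fun l => by
    have := exists_periodic_of_mem_loopsAt l.2.1
      (fun h0 => hn (by rw [← l.2.2, h0, List.length_nil]))
    rwa [l.2.2] at this
  choose f hfl hf using hex
  have hfirst : ∀ l : {l | l ∈ loopsAt A a ∅ ∧ l.length = n},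
      (l : List ℕ) = firstSymbols (f l) n := fun l => by
    refine List.ext_getElem (by rw [length_firstSymbols, l.2.2]) fun i h₁ h₂ => ?_
    rw [← List.getD_eq_getElem _ 0 h₁, ← hfl l i h₁]
    simp [firstSymbols]
  let F : {l | l ∈ loopsAt A a ∅ ∧ l.length = n} →
      {x : MShift A // (shiftMap A)^[n] x = x ∧ x.seq 0 = a} := fun l => ⟨f l, hf l⟩
  have hF : Function.Injective F := fun l l' h => by
    refine Subtype.ext ?_
    rw [hfirst l, hfirst l', show f l = f l' from congrArg Subtype.val h]
  rw [Zpart, ← ENNReal.tsum_mul_left]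
  refine le_trans (ENNReal.tsum_le_tsum fun l => ?_)
    (ENNReal.tsum_comp_le_tsum_of_injective hF fun x => ENNReal.ofReal (Real.exp (∑' k, |V k|)) *
      ENNReal.ofReal (Real.exp (birkhoff A φ n x.1)))
  have := cylWeight_le hVsum hV (hfl l)
  rwa [l.2.2] at this

lemma TopTrans.wordTransitive (hT : TopTrans A) : WordTransitive A := by
  intro a b
  obtain ⟨w, ⟨hlen, hch, -⟩, hh, hl⟩ := hT a b
  have hw : w ≠ [] := by
    rintro rfl
    simp at hlen
  have hlast : w.getLast hw = b := by
    rw [← hl, List.getLastD_eq_getLast?, List.getLast?_eq_getLast_of_ne_nil hw, Option.getD_some]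
  refine ⟨w.dropLast, ?_, ?_⟩
  · match w, hlen, hh with
    | x :: y :: t, _, hh => simpa using hh
  · rw [← hlast, List.dropLast_append_getLast hw]
    exact hch

end Shift

/-! ## Growth rates and generating series -/

section Growth

lemma EReal.coe_eq_inv_mul_log_ofReal_exp {n : ℕ} (hn : n ≠ 0) (q : ℝ) :
    (q : EReal) = (((n : ℝ)⁻¹ : ℝ) : EReal) *
      ENNReal.log (ENNReal.ofReal (Real.exp (n * q))) := by
  have hn' : (n : ℝ) ≠ 0 := Nat.cast_ne_zero.2 hn
  rw [ENNReal.log_ofReal_of_pos (Real.exp_pos _), Real.log_exp, ← EReal.coe_mul,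
    inv_mul_cancel_left₀ hn']

lemma eventually_le_ofReal_exp {Z : ℕ → ℝ≥0∞} {q : ℝ}
    (h : Filter.atTop.limsup (fun n : ℕ => (((n : ℝ)⁻¹ : ℝ) : EReal) * ENNReal.log (Z n)) < q) :
    ∀ᶠ n : ℕ in atTop, Z n ≤ ENNReal.ofReal (Real.exp (n * q)) := by
  filter_upwards [eventually_lt_of_limsup_lt h, eventually_ne_atTop 0] with n hn hn0
  by_contra! hlt
  refine hn.not_ge ?_
  rw [EReal.coe_eq_inv_mul_log_ofReal_exp hn0 q]
  exact mul_le_mul_of_nonneg_left (ENNReal.log_le_log hlt.le)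
    (EReal.coe_nonneg.2 (by positivity))

lemma frequently_ofReal_exp_le {Z : ℕ → ℝ≥0∞} {q : ℝ}
    (h : q < Filter.atTop.limsup (fun n : ℕ => (((n : ℝ)⁻¹ : ℝ) : EReal) * ENNReal.log (Z n))) :
    ∃ᶠ n : ℕ in atTop, ENNReal.ofReal (Real.exp (n * q)) ≤ Z n := by
  refine ((frequently_lt_of_lt_limsup (by isBoundedDefault) h).and_eventually
    (eventually_ne_atTop 0)).mono fun n ⟨hn, hn0⟩ => ?_
  by_contra! hlt
  refine hn.not_ge ?_
  rw [EReal.coe_eq_inv_mul_log_ofReal_exp hn0 q]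
  exact mul_le_mul_of_nonneg_left (ENNReal.log_le_log hlt.le)
    (EReal.coe_nonneg.2 (by positivity))

lemma tsum_mul_exp_ne_top {L : ℕ → ℝ≥0∞} {C : ℝ≥0∞} {q u : ℝ} (hL : ∀ n, L n ≠ ⊤)
    (hC : C ≠ ⊤) (h : ∀ᶠ n : ℕ in atTop, L n ≤ C * ENNReal.ofReal (Real.exp (n * q)))
    (hu : u + q < 0) :
    ∑' n, L n * ENNReal.ofReal (Real.exp (u * n)) ≠ ⊤ := by
  obtain ⟨N, hN⟩ := eventually_atTop.1 h
  have hr : ENNReal.ofReal (Real.exp (u + q)) < 1 := by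
    rw [← ENNReal.ofReal_one]
    exact (ENNReal.ofReal_lt_ofReal_iff one_pos).2 (Real.exp_lt_one_iff.2 hu)
  rw [← ENNReal.summable.sum_add_tsum_nat_add' (k := N)]
  refine ENNReal.add_ne_top.2 ⟨ENNReal.sum_ne_top.2 fun n _ =>
    ENNReal.mul_ne_top (hL n) ENNReal.ofReal_ne_top, ?_⟩
  refine ne_top_of_le_ne_top
    (b := ∑' n, C * ENNReal.ofReal (Real.exp (u + q)) ^ N * ENNReal.ofReal (Real.exp (u + q)) ^ n)
    ?_ (ENNReal.tsum_le_tsum fun n => ?_)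
  · rw [ENNReal.tsum_mul_left, ENNReal.tsum_geometric]
    exact ENNReal.mul_ne_top (ENNReal.mul_ne_top hC (ENNReal.pow_ne_top ENNReal.ofReal_ne_top))
      (ENNReal.inv_ne_top.2 (tsub_pos_of_lt hr).ne')
  · calc L (n + N) * ENNReal.ofReal (Real.exp (u * (n + N : ℕ)))
        ≤ C * ENNReal.ofReal (Real.exp ((n + N : ℕ) * q)) *
            ENNReal.ofReal (Real.exp (u * (n + N : ℕ))) := mul_le_mul_left (hN _ (by omega)) _
      _ = C * ENNReal.ofReal (Real.exp (u + q)) ^ (N + n) := by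
        rw [mul_assoc, ← ENNReal.ofReal_mul (Real.exp_pos _).le, ← Real.exp_add,
          ← ENNReal.ofReal_pow (Real.exp_pos _).le, ← Real.exp_nat_mul]
        congr 3
        push_cast
        ring
      _ = _ := by rw [pow_add, mul_assoc]

lemma tsum_mul_exp_eq_top {L : ℕ → ℝ≥0∞} {q u : ℝ}
    (h : ∃ᶠ n : ℕ in atTop, ENNReal.ofReal (Real.exp (n * q)) ≤ L n) (hu : 0 < u + q) :
    ∑' n, L n * ENNReal.ofReal (Real.exp (u * n)) = ⊤ := by
  by_contra hne
  have hlt := (ENNReal.tendsto_atTop_zero_of_tsum_ne_top hne).eventually_lt_const one_pos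
  obtain ⟨n, hn, hn1⟩ := (h.and_eventually hlt).exists
  refine hn1.not_ge (le_trans ?_ (mul_le_mul_left hn _))
  rw [← ENNReal.ofReal_mul (Real.exp_pos _).le, ← Real.exp_add, ← ENNReal.ofReal_one]
  refine ENNReal.ofReal_le_ofReal (Real.one_le_exp ?_)
  have : 0 ≤ (n : ℝ) * (u + q) := by positivity
  linarith

lemma tsum_expWeight_eq (g : List ℕ → ℝ≥0∞) (u : ℝ) (S : Set (List ℕ)) :
    ∑' l : S, expWeight g u l = ∑' n : ℕ, (∑' l : {l | l ∈ S ∧ l.length = n}, g l) *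
      ENNReal.ofReal (Real.exp (u * n)) := by
  rw [tsum_eq_tsum_fiber List.length]
  refine tsum_congr fun n => ?_
  rw [← ENNReal.tsum_mul_right]
  refine tsum_congr fun l => ?_
  rw [expWeight, l.2.2]

end Growth

/-! ## Positive recurrence -/

section Recurrence

variable {A : ℕ → ℕ → Prop} {φ : MShift A → ℝ} {V : ℕ → ℝ} {p : ℝ}

lemma tsum_loopsAt_length_ne_top (hA : NoZeroRC A) (hsum : SummablePot A φ) (hVsum : Summable V)
    (hV : ∀ n : ℕ, 1 ≤ n → VarBdd A φ n (V n)) (a n : ℕ) :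
    ∑' l : {l | l ∈ loopsAt A a ∅ ∧ l.length = n}, cylWeight A φ l ≠ ⊤ := by
  have hsub : {l | l ∈ loopsAt A a ∅ ∧ l.length = n} ⊆ {l | l ∈ avoiding A ∅ ∧ l.length = n} :=
    fun l hl => ⟨⟨hl.1.2.1.left_of_append, hl.1.2.2⟩, hl.2⟩
  refine ne_top_of_le_ne_top (ENNReal.pow_ne_top (n := n) (tsum_cylWeight_singleton_ne_top hsum))
    ((ENNReal.tsum_mono_subtype _ hsub).trans
      ((tsum_avoiding_length_le (isWordWeight_cylWeight hA hVsum hV) ∅ n).trans ?_))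
  gcongr
  exact ENNReal.tsum_comp_le_tsum_of_injective Subtype.val_injective _

lemma tsum_loopsAt_expWeight_ne_top (hA : NoZeroRC A) (hsum : SummablePot A φ)
    (hVsum : Summable V) (hV : ∀ n : ℕ, 1 ≤ n → VarBdd A φ n (V n)) (hp : IsPG A φ p)
    (b : ℕ) {u : ℝ} (hu : u < -p) :
    ∑' l : loopsAt A b ∅, expWeight (cylWeight A φ) u l ≠ ⊤ := by
  obtain ⟨q, hpq, hqu⟩ := exists_between (show p < -u by linarith)
  have hlim : PGur A φ b < (q : EReal) := by
    rw [hp b (exists_seq_zero_eq hA b)]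
    exact EReal.coe_lt_coe_iff.2 hpq
  rw [tsum_expWeight_eq]
  refine tsum_mul_exp_ne_top (tsum_loopsAt_length_ne_top hA hsum hVsum hV b)
    (ENNReal.ofReal_ne_top (r := Real.exp (∑' k, |V k|))) (q := q) ?_ (by linarith)
  filter_upwards [eventually_le_ofReal_exp hlim, eventually_ne_atTop 0] with n hn hn0
  exact (tsum_loopsAt_length_le hVsum hV hn0 b).trans (mul_le_mul_right hn _)

lemma tsum_loopsAt_expWeight_eq_top (hA : NoZeroRC A) (hp : IsPG A φ p) (a : ℕ) {u : ℝ}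
    (hu : -p < u) :
    ∑' l : loopsAt A a ∅, expWeight (cylWeight A φ) u l = ⊤ := by
  obtain ⟨q, hqu, hpq⟩ := exists_between (show -u < p by linarith)
  have hlim : (q : EReal) < PGur A φ a := by
    rw [hp a (exists_seq_zero_eq hA a)]
    exact EReal.coe_lt_coe_iff.2 hpq
  rw [tsum_expWeight_eq]
  refine tsum_mul_exp_eq_top (q := q) ?_ (by linarith)
  refine ((frequently_ofReal_exp_le hlim).and_eventually (eventually_ne_atTop 0)).mono
    fun n ⟨hn, hn0⟩ => hn.trans (tsum_periodic_le hn0 fun x hx hxa => ?_)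
  exact hxa ▸ firstSymbols_mem_loopsAt x hx

lemma zpartStar_le (n a : ℕ) :
    ZpartStar A φ (n + 1) a ≤
      ∑' l : {l | l ∈ loopsAtN A a ∅ 1 ∧ l.length = n + 1}, cylWeight A φ l := by
  refine tsum_periodic_le n.succ_ne_zero fun x hx ⟨hxa, hret⟩ => ?_
  refine ⟨hxa ▸ firstSymbols_mem_loopsAt x hx, ?_⟩
  have : a ∉ (List.range n).map (x.seq ∘ Nat.succ) := by
    rw [List.mem_map]
    rintro ⟨k, hk, hka⟩
    exact hret (k + 1) k.succ_pos (by simpa using hk) hka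
  rw [firstSymbols, List.range_succ_eq_map, List.map_cons, List.map_map, hxa,
    List.count_cons_self, List.count_eq_zero_of_not_mem this]

lemma tsum_loopsAtN_one_expWeight_ne_top (hA : NoZeroRC A) (hVsum : Summable V)
    (hV : ∀ n : ℕ, 1 ≤ n → VarBdd A φ n (V n)) {a : ℕ} {u : ℝ}
    (h : ∑' l : avoiding A {a}, expWeight (cylWeight A φ) u l ≠ ⊤) :
    ∑' l : loopsAtN A a ∅ 1, expWeight (cylWeight A φ) u l ≠ ⊤ := by
  have hw := (isWordWeight_cylWeight hA hVsum hV).expWeight u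
  refine ne_top_of_le_ne_top (ENNReal.mul_ne_top (hw.ne_top [a]) h)
    ((tsum_loopsAtN_one_le hw a ∅).trans_eq ?_)
  simp

lemma positive_recurrent (hA : NoZeroRC A) (hTrans : TopTrans A) (hsum : SummablePot A φ)
    (hVsum : Summable V) (hV : ∀ n : ℕ, 1 ≤ n → VarBdd A φ n (V n)) (hp : IsPG A φ p) (a : ℕ) :
    (∑' n : ℕ, ENNReal.ofReal (Real.exp (-((n : ℝ) + 1) * p)) * Zpart A φ (n + 1) a) = ⊤ ∧
    (∑' n : ℕ, ENNReal.ofReal (((n : ℝ) + 1) * Real.exp (-((n : ℝ) + 1) * p))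
      * ZpartStar A φ (n + 1) a) < ⊤ := by
  have hgap := exists_gt_tsum_avoiding_singleton_ne_top (isWordWeight_cylWeight hA hVsum hV)
    hTrans.wordTransitive (tsum_cylWeight_singleton_ne_top hsum)
    (fun b u hu => tsum_loopsAt_expWeight_ne_top hA hsum hVsum hV hp b hu) a
  constructor
  · have htop := tsum_loopsAt_eq_top (isWordWeight_cylWeight hA hVsum hV)
      (fun u hu => tsum_loopsAt_expWeight_eq_top hA hp a hu) hgap
    rw [tsum_expWeight_eq] at htop
    have htop' := ENNReal.tsum_add_one_eq_top htop
      (ENNReal.mul_ne_top (tsum_loopsAt_length_ne_top hA hsum hVsum hV a 0) ENNReal.ofReal_ne_top)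
    have hle : ∑' n : ℕ, (∑' l : {l | l ∈ loopsAt A a ∅ ∧ l.length = n + 1}, cylWeight A φ l) *
        ENNReal.ofReal (Real.exp (-p * (n + 1 : ℕ))) ≤
        ENNReal.ofReal (Real.exp (∑' k, |V k|)) *
          ∑' n : ℕ, ENNReal.ofReal (Real.exp (-((n : ℝ) + 1) * p)) * Zpart A φ (n + 1) a := by
      rw [← ENNReal.tsum_mul_left]
      refine ENNReal.tsum_le_tsum fun n => ?_
      refine (mul_le_mul_left (tsum_loopsAt_length_le hVsum hV n.succ_ne_zero a) _).trans_eq ?_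
      rw [mul_assoc, mul_comm (Zpart A φ (n + 1) a)]
      congr 4
      push_cast
      ring
    by_contra hne
    exact ENNReal.mul_ne_top ENNReal.ofReal_ne_top hne (top_le_iff.1 (htop' ▸ hle))
  · obtain ⟨u, hu, hfin⟩ := hgap
    have hε : 0 < u + p := by linarith
    have hloops := tsum_loopsAtN_one_expWeight_ne_top hA hVsum hV hfin
    rw [tsum_expWeight_eq] at hloops
    refine lt_of_le_of_lt ?_ (ENNReal.mul_ne_top
      (ENNReal.ofReal_ne_top (r := (u + p)⁻¹)) hloops).lt_top
    refine le_trans ?_ (mul_le_mul_right (ENNReal.tsum_comp_le_tsum_of_injective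
      (add_left_injective 1) _) _)
    rw [← ENNReal.tsum_mul_left]
    refine ENNReal.tsum_le_tsum fun n => ?_
    rw [mul_comm (∑' l : {l | l ∈ loopsAtN A a ∅ 1 ∧ l.length = n + 1}, cylWeight A φ l),
      ← mul_assoc, ← ENNReal.ofReal_mul (inv_nonneg.2 hε.le)]
    refine mul_le_mul' (ENNReal.ofReal_le_ofReal ?_) (zpartStar_le n a)
    rw [inv_mul_eq_div, le_div_iff₀ hε]
    have h₁ : ((n : ℝ) + 1) * (u + p) ≤ Real.exp (((n : ℝ) + 1) * (u + p)) :=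
      (by linarith : _ ≤ ((n : ℝ) + 1) * (u + p) + 1).trans (Real.add_one_le_exp _)
    calc ((n : ℝ) + 1) * Real.exp (-((n : ℝ) + 1) * p) * (u + p)
        = ((n : ℝ) + 1) * (u + p) * Real.exp (-((n : ℝ) + 1) * p) := by ring
      _ ≤ Real.exp (((n : ℝ) + 1) * (u + p)) * Real.exp (-((n : ℝ) + 1) * p) := by gcongr
      _ = Real.exp (u * (n + 1 : ℕ)) := by
        rw [← Real.exp_add]
        push_cast
        ring_nf

lemma SummablePot.const_mul (h : SummablePot A φ) {t : ℝ} (ht : 1 ≤ t) :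
    SummablePot A fun x => t * φ x := by
  obtain ⟨s, hs, hφ⟩ := h
  refine ⟨fun i => t * s i, ?_, fun i x hx => mul_le_mul_of_nonneg_left (hφ i x hx) (by linarith)⟩
  refine Summable.of_norm_bounded_eventually_nat hs ?_
  filter_upwards [hs.tendsto_atTop_zero.eventually_le_const one_pos] with i hi
  have hi' : s i ≤ 0 := Real.exp_le_one_iff.1 hi
  rw [Real.norm_of_nonneg (Real.exp_pos _).le]
  exact Real.exp_le_exp.2 (by nlinarith)

lemma VarBdd.const_mul {n : ℕ} {v : ℝ} (h : VarBdd A φ n v) {t : ℝ} (ht : 0 ≤ t) :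
    VarBdd A (fun x => t * φ x) n (t * v) := fun x y hxy => by
  rw [← mul_sub, abs_mul, abs_of_nonneg ht]
  exact mul_le_mul_of_nonneg_left (h x y hxy) ht

end Recurrence

/-- For every `t ≥ 1` the potential `tφ` is positive recurrent. -/
theorem stmt5 (A : ℕ → ℕ → Prop) (hA : NoZeroRC A) (hTrans : TopTrans A)
    (φ : MShift A → ℝ) (hsum : SummablePot A φ)
    (V : ℕ → ℝ) (hVsum : Summable V) (hV : ∀ n : ℕ, 1 ≤ n → VarBdd A φ n (V n))
    (hfin : ∀ a : ℕ, PGur A φ a < ⊤) :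
    ∀ t : ℝ, 1 ≤ t → ∀ p : ℝ, IsPG A (fun x => t * φ x) (p : EReal) → ∀ a : ℕ,
      (∑' n : ℕ, ENNReal.ofReal (Real.exp (-((n : ℝ) + 1) * p))
          * Zpart A (fun x => t * φ x) (n + 1) a) = ⊤ ∧
      (∑' n : ℕ, ENNReal.ofReal (((n : ℝ) + 1) * Real.exp (-((n : ℝ) + 1) * p))
          * ZpartStar A (fun x => t * φ x) (n + 1) a) < ⊤ := by
  intro t ht p hp a
  exact positive_recurrent hA hTrans (hsum.const_mul ht) (hVsum.mul_left t)
    (fun n hn => (hV n hn).const_mul (by linarith)) hp a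
end
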